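/- arXiv:2112.12096 — 2 statements merged into one kernel-verified Lean document; each statement's English description precedes it below -/
import Mathlib

section
/- Fix u ∈ I and x ∈ ℤ^d \ {0}. Assume that the edge weights (t_e^ω)_{e∈E_d} are stationary and ergodic under P^u and that E^u[t_e^ω] < ∞ for every edge e (so that the time constant μ_u(x) exists). If lim_{n→∞} P^u( 0 is connected to nx by a path consisting only of edges e with t_e^ω = 0 ) > 0, then μ_u(x) = 0. -/
open MeasureTheory Filter ENNReal Topology
open scoped Classical

namespace FPPPaper

/-! ## Basic geometry of `ℤ^d` -/

/-- Vertices of the lattice `ℤ^d`. -/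
abbrev Vert (d : ℕ) := Fin d → ℤ

/-- Nearest-neighbour adjacency on `ℤ^d`. -/
def adj {d : ℕ} (x y : Vert d) : Prop := (∑ i, (x i - y i).natAbs) = 1

/-- The `ℓ^∞`-distance on `ℤ^d`. -/
def linfDist {d : ℕ} (x y : Vert d) : ℕ := Finset.univ.sup fun i => (x i - y i).natAbs

/-- The `ℓ^1`-distance on `ℤ^d`. -/
def l1Dist {d : ℕ} (x y : Vert d) : ℕ := ∑ i, (x i - y i).natAbs

/-- The canonical embedding `ℤ^d → ℝ^d`. -/
def toRvec {d : ℕ} (x : Vert d) : Fin d → ℝ := fun i => (x i : ℝ)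

/-- `p` is a nearest-neighbour path from `x` to `y` (a list of consecutively
adjacent vertices starting at `x` and ending at `y`). -/
def IsPathFrom {d : ℕ} (x y : Vert d) (p : List (Vert d)) : Prop :=
  p.head? = some x ∧ p.getLast? = some y ∧ p.Chain' adj

/-- The (ordered) edges traversed by a path. -/
def edgesOf {d : ℕ} (p : List (Vert d)) : List (Vert d × Vert d) := p.zip p.tail

/-- Total weight of a path for edge weights `w`. -/
noncomputable def pathWeight {d : ℕ} (w : Vert d → Vert d → ℝ≥0∞) (p : List (Vert d)) :
    ℝ≥0∞ :=
  ((edgesOf p).map fun e => w e.1 e.2).sum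

/-- The first passage percolation (pseudo-)distance associated to edge weights `w`. -/
noncomputable def fppDist {d : ℕ} (w : Vert d → Vert d → ℝ≥0∞) (x y : Vert d) : ℝ≥0∞ :=
  ⨅ p : {p : List (Vert d) // IsPathFrom x y p}, pathWeight w p.1

/-- Total weight of a path for vertex weights `w`. -/
noncomputable def vertPathWeight {d : ℕ} (w : Vert d → ℝ≥0∞) (p : List (Vert d)) : ℝ≥0∞ :=
  (p.map w).sum

/-- The first passage percolation distance associated to vertex weights `w`. -/
noncomputable def vfppDist {d : ℕ} (w : Vert d → ℝ≥0∞) (x y : Vert d) : ℝ≥0∞ :=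
  ⨅ p : {p : List (Vert d) // IsPathFrom x y p}, vertPathWeight w p.1

/-- `x` and `y` are connected by a path all of whose edges belong to `S`. -/
def ConnectedIn {d : ℕ} (S : Set (Vert d × Vert d)) (x y : Vert d) : Prop :=
  ∃ p, IsPathFrom x y p ∧ ∀ e ∈ edgesOf p, e ∈ S

/-- `x` and `y` are connected by a path all of whose vertices belong to `S`. -/
def VConnectedIn {d : ℕ} (S : Set (Vert d)) (x y : Vert d) : Prop :=
  ∃ p, IsPathFrom x y p ∧ ∀ v ∈ p, v ∈ S

/-- The cube `Q(x,r) = {y : |x-y|_∞ ≤ r}`. -/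
def cubeVerts {d : ℕ} (x : Vert d) (r : ℝ) : Set (Vert d) :=
  {y | ∀ i, |(y i : ℝ) - (x i : ℝ)| ≤ r}

/-- The set of edges with weight zero. -/
def zeroSet {d : ℕ} (w : Vert d → Vert d → ℝ≥0∞) : Set (Vert d × Vert d) :=
  {e | adj e.1 e.2 ∧ w e.1 e.2 = 0}

/-! ## Configuration spaces indexed by vertices and edges -/

/-- Index set for configurations: vertices and (ordered) edges of `ℤ^d`. -/
abbrev Coord (d : ℕ) := Vert d ⊕ (Vert d × Vert d)

/-- The vertices underlying a coordinate. -/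
def coordVerts {d : ℕ} : Coord d → Set (Vert d)
  | Sum.inl v => {v}
  | Sum.inr e => {e.1, e.2}

/-- The configuration space `Ω = ∏_{e} Ω_e × ∏_x Ω_x` with all coordinate spaces
equal to `Γ`. -/
abbrev Config (d : ℕ) (Γ : Type*) := Coord d → Γ

/-- The lattice shift `τ_z` on configurations. -/
def shiftConfig {d : ℕ} {Γ : Type*} (z : Vert d) (ω : Config d Γ) : Config d Γ :=
  fun c => ω (match c with
    | Sum.inl v => Sum.inl (v + z)
    | Sum.inr e => Sum.inr (e.1 + z, e.2 + z))

/-- A function of the configuration is supported on the set `S` of coordinates. -/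
def SupportedOn {d : ℕ} {Γ β : Type*} (S : Set (Coord d)) (f : Config d Γ → β) : Prop :=
  ∀ ω ω' : Config d Γ, (∀ c ∈ S, ω c = ω' c) → f ω = f ω'

/-- An event on pairs of configurations depending only on the coordinates of the first
configuration in `S1` and of the second one in `S2`. -/
def PairSupportedOn {d : ℕ} {Γ : Type*} (S1 S2 : Set (Coord d))
    (A : Set (Config d Γ × Config d Γ)) : Prop :=
  ∀ ω1 ω2 ω1' ω2' : Config d Γ, (∀ c ∈ S1, ω1 c = ω1' c) → (∀ c ∈ S2, ω2 c = ω2' c) →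
    ((ω1, ω2) ∈ A ↔ (ω1', ω2') ∈ A)

/-- The coordinates of the box `Q̄(x,r)`: vertices of the cube `Q(x,r)` together with
the edges having both endpoints in the cube. -/
def boxCoords {d : ℕ} (x : Vert d) (r : ℝ) : Set (Coord d) :=
  {c | ∀ v ∈ coordVerts c, v ∈ cubeVerts x r}

/-- The coordinates within `ℓ^∞`-distance `r` of `x` or `y` (the neighbourhoods
`𝒩 + x` and `𝒩 + y` together with the edge `{x,y}`). -/
def nbhdCoords {d : ℕ} (r : ℕ) (x y : Vert d) : Set (Coord d) :=
  {c | ∀ v ∈ coordVerts c, linfDist v x ≤ r ∨ linfDist v y ≤ r}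

/-- Two sets of coordinates are at mutual distance at least `r`. -/
def coordSetsFar {d : ℕ} (S1 S2 : Set (Coord d)) (r : ℝ) : Prop :=
  ∀ c1 ∈ S1, ∀ c2 ∈ S2, ∀ v1 ∈ coordVerts c1, ∀ v2 ∈ coordVerts c2,
    r ≤ (linfDist v1 v2 : ℝ)

/-! ## The conditions P1, P2, P3, P3', S1, S2 and Z -/

/-- Condition **P1** (invariance and directional ergodicity): each `P u` is invariant
under lattice shifts and every event invariant under a nonzero shift is trivial. -/
def CondP1 {d : ℕ} {Γ : Type*} [MeasurableSpace Γ]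
    (P : ℝ → Measure (Config d Γ)) (I : Set ℝ) : Prop :=
  ∀ u ∈ I, (∀ z : Vert d, MeasurePreserving (shiftConfig z) (P u) (P u)) ∧
    (∀ z : Vert d, z ≠ 0 → ∀ A : Set (Config d Γ), MeasurableSet A →
      shiftConfig z ⁻¹' A = A → P u A = 0 ∨ P u A = 1)

/-- Condition **P2** (stochastic monotonicity in the parameter `u`). -/
def CondP2 {d : ℕ} {Γ : Type*} [MeasurableSpace Γ] [Preorder Γ]
    (P : ℝ → Measure (Config d Γ)) (I : Set ℝ) : Prop :=
  ∀ f : Config d Γ → ℝ, Measurable f → Monotone f → (∀ ω, f ω ∈ Set.Icc (0:ℝ) 1) →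
    ∀ u ∈ I, ∀ u' ∈ I, u ≤ u' → ∫ ω, f ω ∂(P u) ≤ ∫ ω, f ω ∂(P u')

/-- Condition **P3** (decoupling inequality with sprinkling): after possibly
extending the underlying probability space (the extension is given by `Ω'`, `π`
and the family `Q`), for distant boxes and sprinkled levels there is an event `B`
of high probability on which increasing (resp. decreasing) events on the two boxes
can be compared with their probabilities under independent copies. -/
def CondP3 {d : ℕ} {Γ : Type*} [MeasurableSpace Γ] [Preorder Γ]
    (P : ℝ → Measure (Config d Γ)) (I : Set ℝ)
    (ξP εP aP CP χP RP LP : ℝ) : Prop :=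
  1 < ξP ∧ 0 < εP ∧ 0 < aP ∧ 0 < CP ∧ 0 < χP ∧ 0 < RP ∧ 0 < LP ∧
  ∃ (Ω' : Type) (mΩ' : MeasurableSpace Ω') (π : Ω' → Config d Γ)
    (Q : ℝ → @Measure Ω' mΩ') (fP : ℝ → ℝ),
    (@Measurable Ω' (Config d Γ) mΩ' _ π) ∧
    (∀ u ∈ I, @Measure.map Ω' (Config d Γ) mΩ' _ π (Q u) = P u) ∧
    (∀ L : ℝ, LP ≤ L → Real.exp (aP * Real.log L ^ εP) ≤ fP L) ∧
    ∀ (R L : ℝ) (x1 x2 : Vert d) (u uh : ℝ), u ∈ I → uh ∈ I → RP ≤ R → LP ≤ L →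
      (∀ v1 ∈ cubeVerts x1 (L ^ ξP), ∀ v2 ∈ cubeVerts x2 (L ^ ξP),
        R * L ≤ (linfDist v1 v2 : ℝ)) →
      uh + R ^ (-χP) ≤ u →
      ∃ B : Set Ω', @MeasurableSet Ω' mΩ' B ∧
        Q u Bᶜ ≤ ENNReal.ofReal (Real.exp (-(CP * fP L))) ∧
        (∀ A : Set (Config d Γ × Config d Γ), MeasurableSet A → IsUpperSet A →
            PairSupportedOn (boxCoords x1 (L ^ ξP)) (boxCoords x2 (L ^ ξP)) A →
            Q uh {ω' | ω' ∈ B ∧ (π ω', π ω') ∈ A} ≤ ((P u).prod (P u)) A) ∧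
        (∀ A : Set (Config d Γ × Config d Γ), MeasurableSet A → IsLowerSet A →
            PairSupportedOn (boxCoords x1 (L ^ ξP)) (boxCoords x2 (L ^ ξP)) A →
            Q u {ω' | ω' ∈ B ∧ (π ω', π ω') ∈ A} ≤ ((P uh).prod (P uh)) A)

/-- Condition **P3'** (decoupling inequality for sparse sets with super-exponential
error term). -/
def CondP3' {d : ℕ} {Γ : Type*} [MeasurableSpace Γ] [Preorder Γ]
    (P : ℝ → Measure (Config d Γ)) (I : Set ℝ)
    (ξP CP χP RP LP : ℝ) : Prop :=
  1 < ξP ∧ 0 < CP ∧ 0 < χP ∧ 0 < RP ∧ 0 < LP ∧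
  ∀ (R L : ℝ) (x1 x2 : Vert d) (u uh : ℝ), u ∈ I → uh ∈ I → RP ≤ R → LP ≤ L →
    uh + R ^ (-χP) ≤ u →
    ∀ S1 S2 : Set (Coord d), S1 ⊆ boxCoords x1 (L ^ ξP) → S2 ⊆ boxCoords x2 (L ^ ξP) →
      (S1.ncard : ℝ) ≤ L ^ ξP → (S2.ncard : ℝ) ≤ L ^ ξP →
      coordSetsFar S1 S2 (R * L) →
      (∀ f1 f2 : Config d Γ → ℝ, Measurable f1 → Measurable f2 →
        Monotone f1 → Monotone f2 →
        (∀ ω, f1 ω ∈ Set.Icc (0:ℝ) 1) → (∀ ω, f2 ω ∈ Set.Icc (0:ℝ) 1) →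
        SupportedOn S1 f1 → SupportedOn S2 f2 →
        ∫ ω, f1 ω * f2 ω ∂(P uh) ≤ (∫ ω, f1 ω ∂(P u)) * (∫ ω, f2 ω ∂(P u))
          + Real.exp (-(CP * L ^ ξP))) ∧
      (∀ f1 f2 : Config d Γ → ℝ, Measurable f1 → Measurable f2 →
        Antitone f1 → Antitone f2 →
        (∀ ω, f1 ω ∈ Set.Icc (0:ℝ) 1) → (∀ ω, f2 ω ∈ Set.Icc (0:ℝ) 1) →
        SupportedOn S1 f1 → SupportedOn S2 f2 →
        ∫ ω, f1 ω * f2 ω ∂(P u) ≤ (∫ ω, f1 ω ∂(P uh)) * (∫ ω, f2 ω ∂(P uh))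
          + Real.exp (-(CP * L ^ ξP)))

/-- Condition **(Z)**: `liminf_{L→∞} sup_x P^u(Q(x,L) ↔ Q(x,2L)^c in {e : t_e = 0}) = 0`
for every `u ∈ I`. -/
def CondZ {d : ℕ} {Γ : Type*} [MeasurableSpace Γ]
    (P : ℝ → Measure (Config d Γ)) (I : Set ℝ)
    (w : Config d Γ → Vert d → Vert d → ℝ≥0∞) : Prop :=
  ∀ u ∈ I,
    Filter.liminf (fun L : ℕ =>
      ⨆ x : Vert d, P u {ω | ∃ v1 ∈ cubeVerts x (L : ℝ), ∃ v2,
        v2 ∉ cubeVerts x ((2 * L : ℕ) : ℝ) ∧ ConnectedIn (zeroSet (w ω)) v1 v2})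
      Filter.atTop = 0

/-- The function `g_P^{(δ)}` of the main theorem: equal to `L` if condition P3' holds
and otherwise given by the P3-formula. -/
noncomputable def gP3formula (δ εP aP χP L : ℝ) : ℝ :=
  min L (Real.log L ^ (-(δ * (1 + aP + aP / χP))) * Real.exp (aP * Real.log L ^ εP))

noncomputable def gdelta (p3' : Prop) (δ εP aP χP L : ℝ) : ℝ :=
  if p3' then L else gP3formula δ εP aP χP L

/-! ## The renormalization scheme -/

/-- `ρ_k = ρ` for `k < K` and `ρ_k = 1` for `k ≥ K`. -/
def rhok (ρ K k : ℕ) : ℕ := if k < K then ρ else 1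

/-- The sequence of scales `L_{k+1} = 2 L_k (1 + ρ_k/(k+6)^δ)`. -/
noncomputable def Lseq (δ : ℝ) (ρ K : ℕ) (L0 : ℝ) : ℕ → ℝ
  | 0 => L0
  | k + 1 => 2 * Lseq δ ρ K L0 k * (1 + (rhok ρ K k : ℝ) / ((k : ℝ) + 6) ^ δ)

/-- The box `C_x^k = x + [0, L_k)^d ∩ ℤ^d`. -/
def CkSet {d : ℕ} (δ : ℝ) (ρ K : ℕ) (L0 : ℝ) (k : ℕ) (x : Vert d) : Set (Vert d) :=
  {y | ∀ i, (0:ℝ) ≤ ((y i - x i : ℤ) : ℝ) ∧ ((y i - x i : ℤ) : ℝ) < Lseq δ ρ K L0 k}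

/-- The box `D_x^k = x + [-L_k, 2 L_k)^d ∩ ℤ^d`. -/
def DkSet {d : ℕ} (δ : ℝ) (ρ K : ℕ) (L0 : ℝ) (k : ℕ) (x : Vert d) : Set (Vert d) :=
  {y | ∀ i, -(Lseq δ ρ K L0 k) ≤ ((y i - x i : ℤ) : ℝ) ∧
    ((y i - x i : ℤ) : ℝ) < 2 * Lseq δ ρ K L0 k}

/-- `d_k^ω(x)`: the FPP distance between `C_x^k` and the complement of `D_x^k`. -/
noncomputable def dkDist {d : ℕ} (δ : ℝ) (ρ K : ℕ) (L0 : ℝ) (k : ℕ) (x : Vert d)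
    (w : Vert d → Vert d → ℝ≥0∞) : ℝ≥0∞ :=
  ⨅ p : {p : List (Vert d) // ∃ a b, a ∈ CkSet δ ρ K L0 k x ∧ b ∉ DkSet δ ρ K L0 k x ∧
      IsPathFrom a b p}, pathWeight w p.1

/-- `ε_k = Σ_{p ≥ k} ε/(p+6)^δ`. -/
noncomputable def epsk (δ ε : ℝ) (k : ℕ) : ℝ :=
  ∑' j : ℕ, ε / (((k + j : ℕ) : ℝ) + 6) ^ δ

/-- `a_k = 2^k ∏_{i=0}^{k-1} (1 - 1/(i+6)^δ)`. -/
noncomputable def aseq (δ : ℝ) (k : ℕ) : ℝ :=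
  2 ^ k * ∏ i ∈ Finset.range k, (1 - 1 / (((i : ℕ) : ℝ) + 6) ^ δ)

/-- A path visits `A` and visits the complement of `B` ("the path connects `A` to
`B^c`"). -/
def Crosses {d : ℕ} (p : List (Vert d)) (A B : Set (Vert d)) : Prop :=
  (∃ v ∈ p, v ∈ A) ∧ (∃ v ∈ p, v ∉ B)

/-- Two sets of vertices at mutual `ℓ^∞`-distance at least `r`. -/
def SetDistGE {d : ℕ} (A B : Set (Vert d)) (r : ℝ) : Prop :=
  ∀ a ∈ A, ∀ b ∈ B, r ≤ (linfDist a b : ℝ)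

/-- A proper embedding of the binary tree of depth `k` with base `x`, where tree
vertices of depth `n` are encoded as lists of booleans of length `n` and children
are obtained by appending a bit. -/
def ProperEmbedding {d : ℕ} (δ : ℝ) (ρ K : ℕ) (L0 : ℝ)
    (xseq yseq : ℕ → ℕ → Vert d) (k : ℕ) (x : Vert d) (τ : List Bool → Vert d) : Prop :=
  τ [] = x ∧
  (∀ n, n < k → ∀ σ : List Bool, σ.length = n →
    ∃ i < (2 + rhok ρ K (k - n - 1)) ^ d, ∃ j < 2 * d * (6 + rhok ρ K (k - n - 1)) ^ (d - 1),
      τ (σ ++ [true]) = τ σ + xseq (k - n - 1) i ∧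
      τ (σ ++ [false]) = τ σ + yseq (k - n - 1) j) ∧
  (∀ n, n < k → ∀ σ σ' : List Bool, σ.length = n → σ'.length = k - n →
    (DkSet δ ρ K L0 (k - n) (τ σ) ∩ DkSet δ ρ K L0 0 (τ (σ ++ σ'))).Nonempty)

/-- The countable product measure `ν = μ^{⊗ℕ}` characterised on cylinders. -/
def IsIIDProduct {Ω : Type*} [MeasurableSpace Ω] (μ : Measure Ω)
    (ν : Measure (ℕ → Ω)) : Prop :=
  ∀ (s : Finset ℕ) (f : ℕ → Set Ω), (∀ i ∈ s, MeasurableSet (f i)) →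
    ν {ωt | ∀ i ∈ s, ωt i ∈ f i} = ∏ i ∈ s, μ (f i)

/-- The Lorentz `L(d,1)`-norm of a nonnegative random variable. -/
noncomputable def lorentzNorm {Ω : Type*} [MeasurableSpace Ω] (d : ℕ) (P : Measure Ω)
    (X : Ω → ℝ≥0∞) : ℝ≥0∞ :=
  ∫⁻ s in Set.Ioi (0:ℝ), (P {ω | ENNReal.ofReal s < X ω}) ^ ((1:ℝ) / d)

/-! ## The discrete Gaussian free field -/

/-- The neighbours of a vertex of `ℤ^d`. -/
def nbrs {d : ℕ} (x : Vert d) : Finset (Vert d) :=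
  (Finset.univ : Finset (Fin d × Bool)).image
    (fun p => Function.update x p.1 (x p.1 + if p.2 then 1 else -1))

/-- The number of nearest-neighbour walks of length `n` from `x` to `y`. -/
def nStepCount (d : ℕ) : ℕ → Vert d → Vert d → ℕ
  | 0, x, y => if x = y then 1 else 0
  | n + 1, x, y => ∑ z ∈ nbrs x, nStepCount d n z y

/-- The Green function of the simple random walk on `ℤ^d` (with unit weights). -/
noncomputable def greenSRW (d : ℕ) (x y : Vert d) : ℝ≥0∞ :=
  ∑' n : ℕ, (nStepCount d n x y : ℝ≥0∞) / ((2 * d : ℕ) : ℝ≥0∞) ^ n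

/-- `φ` is a centred Gaussian field with covariance `cov` under `P`, characterised by
the moment generating functions of its finite linear combinations. -/
def IsCenteredGaussianField {d : ℕ} {Ω : Type*} [MeasurableSpace Ω] (P : Measure Ω)
    (φ : Ω → Vert d → ℝ) (cov : Vert d → Vert d → ℝ) : Prop :=
  (∀ x, Measurable fun ω => φ ω x) ∧
  ∀ (s : Finset (Vert d)) (c : Vert d → ℝ) (t : ℝ),
    ∫ ω, Real.exp (t * ∑ x ∈ s, c x * φ ω x) ∂P =
      Real.exp (t ^ 2 * (∑ x ∈ s, ∑ y ∈ s, c x * c y * cov x y) / 2)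

/-- The set `S` of vertices percolates (contains an infinite cluster). -/
def PercolatesIn {d : ℕ} (S : Set (Vert d)) : Prop :=
  ∃ x, {y | VConnectedIn S x y}.Infinite

/-- The critical level `h_*` for level-set percolation of the field `φ`. -/
noncomputable def hstar {d : ℕ} {Ω : Type*} [MeasurableSpace Ω] (P : Measure Ω)
    (φ : Ω → Vert d → ℝ) : ℝ :=
  sSup {h : ℝ | P {ω | PercolatesIn {x | h ≤ φ ω x}} ≠ 0}

/-- `h_f = inf {t : f t = 0}` as an extended real number (`⊤` if `f` has no zero). -/
noncomputable def hfEReal (f : ℝ → ℝ) : EReal :=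
  sInf {x : EReal | ∃ s : ℝ, f s = 0 ∧ x = (s : EReal)}

/-! ## Random conductance models -/

/-- An edge is open for conductances `a` if it is a lattice edge with positive
conductance. -/
def openAdj {d : ℕ} (a : Vert d → Vert d → ℝ) (x y : Vert d) : Prop :=
  adj x y ∧ 0 < a x y

/-- A path using only open edges. -/
def IsOpenPath {d : ℕ} (a : Vert d → Vert d → ℝ) (x y : Vert d) (p : List (Vert d)) :
    Prop :=
  p.head? = some x ∧ p.getLast? = some y ∧ p.Chain' (openAdj a)

/-- Connectivity by open paths. -/
def openConn {d : ℕ} (a : Vert d → Vert d → ℝ) (x y : Vert d) : Prop :=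
  ∃ p, IsOpenPath a x y p

/-- The union of the infinite open clusters (the infinite cluster `C_∞` when it is
unique). -/
def Cinf {d : ℕ} (a : Vert d → Vert d → ℝ) : Set (Vert d) :=
  {x | {y | openConn a x y}.Infinite}

/-- The chemical (graph) distance on the open cluster. -/
noncomputable def chemDist {d : ℕ} (a : Vert d → Vert d → ℝ) (x y : Vert d) : ℝ≥0∞ :=
  ⨅ p : {p : List (Vert d) // IsOpenPath a x y p}, ((p.1.length - 1 : ℕ) : ℝ≥0∞)

/-- The closed ball of radius `r` for the chemical distance. -/
def ballCh {d : ℕ} (a : Vert d → Vert d → ℝ) (x : Vert d) (r : ℝ) : Set (Vert d) :=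
  {y | chemDist a x y ≤ ENNReal.ofReal r}

/-- `μ^ω(x) = Σ_{y∼x} a(x,y)`. -/
noncomputable def muA {d : ℕ} (a : Vert d → Vert d → ℝ) (x : Vert d) : ℝ :=
  ∑ y ∈ nbrs x, a x y

/-- `ν^ω(x) = Σ_{y∼x, a(x,y)>0} a(x,y)⁻¹`. -/
noncomputable def nuA {d : ℕ} (a : Vert d → Vert d → ℝ) (x : Vert d) : ℝ :=
  ∑ y ∈ nbrs x, if 0 < a x y then (a x y)⁻¹ else 0

/-- The space-averaged `ℓ^p`-norm `‖f‖_{p,A}` (maximum norm for `p = ∞`). -/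
noncomputable def avgNormR {d : ℕ} (p : ℝ≥0∞) (A : Set (Vert d)) (f : Vert d → ℝ) : ℝ :=
  if p = ∞ then sSup ((fun x => |f x|) '' A)
  else ((∑' x : A, |f (x : Vert d)| ^ p.toReal) / (A.ncard : ℝ)) ^ (1 / p.toReal)

/-- The sum `Σ_{{y,z} open edge} |f(y) - f(z)|` (each unordered edge counted once). -/
noncomputable def edgeGradSum {d : ℕ} (a : Vert d → Vert d → ℝ) (f : Vert d → ℝ) : ℝ :=
  (1 / 2) * ∑' e : Vert d × Vert d, if openAdj a e.1 e.2 then |f e.2 - f e.1| else 0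

/-- The graph assumption: volume regularity of order `d` and a Sobolev inequality
with exponent `d' ≥ d` on large balls of the infinite cluster. -/
def GraphAssumption {d : ℕ} (d' : ℝ) (a : Vert d → Vert d → ℝ)
    (N4 N5 : Vert d → ℕ) (Creg CS1 : ℝ) : Prop :=
  1 ≤ Creg ∧ 1 ≤ CS1 ∧ (d : ℝ) ≤ d' ∧
  (∀ x ∈ Cinf a, ∀ n : ℕ, N4 x ≤ n →
    Creg⁻¹ * (n : ℝ) ^ d ≤ ((ballCh a x n).ncard : ℝ) ∧
      ((ballCh a x n).ncard : ℝ) ≤ Creg * (n : ℝ) ^ d) ∧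
  (∀ x ∈ Cinf a, ∀ n : ℕ, N5 x ≤ n → ∀ f : Vert d → ℝ,
    (∀ y, f y ≠ 0 → y ∈ ballCh a x n) →
    avgNormR (ENNReal.ofReal (d' / (d' - 1))) (ballCh a x n) f ≤
      CS1 * n / ((ballCh a x n).ncard : ℝ) * edgeGradSum a f)

/-- The generator `(ℒ f)(x) = Σ_{y∼x} a(x,y)(f(y)-f(x)) - h κ(x) f(x)`. -/
noncomputable def genL {d : ℕ} (a : Vert d → Vert d → ℝ) (κ : Vert d → ℝ) (h : ℝ)
    (f : Vert d → ℝ) (x : Vert d) : ℝ :=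
  (∑ y ∈ nbrs x, a x y * (f y - f x)) - h * κ x * f x

/-- The carré du champ `Γ(f,g)(x) = Σ_{y∼x} a(x,y)(f(y)-f(x))(g(y)-g(x))`. -/
noncomputable def carre {d : ℕ} (a : Vert d → Vert d → ℝ) (f g : Vert d → ℝ)
    (x : Vert d) : ℝ :=
  ∑ y ∈ nbrs x, a x y * (f y - f x) * (g y - g x)

/-- The weighted carré du champ
`Γ_η(f,g)(x) = Σ_{y∼x} av(η²)({x,y}) a(x,y)(f(y)-f(x))(g(y)-g(x))`. -/
noncomputable def carreEta {d : ℕ} (a : Vert d → Vert d → ℝ) (η f g : Vert d → ℝ)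
    (x : Vert d) : ℝ :=
  ∑ y ∈ nbrs x, ((η x ^ 2 + η y ^ 2) / 2) * (a x y * (f y - f x) * (g y - g x))

/-- The Dirichlet form `E(f) = ⟨∇f, a ∇f⟩ + h ⟨f, κ f⟩`. -/
noncomputable def dirichletE {d : ℕ} (a : Vert d → Vert d → ℝ) (κ : Vert d → ℝ)
    (h : ℝ) (f : Vert d → ℝ) : ℝ :=
  (1 / 2) * (∑' e : Vert d × Vert d,
      if adj e.1 e.2 then a e.1 e.2 * (f e.2 - f e.1) ^ 2 else 0) +
    h * ∑' x, κ x * f x ^ 2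

/-- `g` is the Green function on `C` of the walk with conductances `a` and killing
measure `h·κ`: the minimal nonnegative fundamental solution of `ℒ g(·,y) = -𝟙_y`. -/
def IsGreenFn {d : ℕ} (a : Vert d → Vert d → ℝ) (κ : Vert d → ℝ) (h : ℝ)
    (C : Set (Vert d)) (g : Vert d → Vert d → ℝ) : Prop :=
  (∀ x y, 0 ≤ g x y) ∧
  (∀ y ∈ C, ∀ x ∈ C, genL a κ h (fun z => g z y) x = -(if x = y then (1:ℝ) else 0)) ∧
  (∀ g' : Vert d → Vert d → ℝ, (∀ x y, 0 ≤ g' x y) →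
    (∀ y ∈ C, ∀ x ∈ C, genL a κ h (fun z => g' z y) x ≤ -(if x = y then (1:ℝ) else 0)) →
    ∀ x ∈ C, ∀ y ∈ C, g x y ≤ g' x y)

/-- `q t x y = P_x(X_t = y)` is the (minimal) transition function of the Markov chain
with jump rates `a(x,y)/θ(x)`, characterised via the backward Kolmogorov equations. -/
def IsHeatSemigroup {d : ℕ} (a : Vert d → Vert d → ℝ) (θ : Vert d → ℝ)
    (q : ℝ → Vert d → Vert d → ℝ) : Prop :=
  (∀ x y, q 0 x y = if x = y then (1:ℝ) else 0) ∧
  (∀ t x y, 0 ≤ q t x y) ∧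
  (∀ t x, ∑' y, q t x y ≤ 1) ∧
  (∀ x y, ∀ t : ℝ, 0 ≤ t →
    HasDerivAt (fun s => q s x y) (∑ z ∈ nbrs x, a x z / θ x * (q t z y - q t x y)) t) ∧
  (∀ q' : ℝ → Vert d → Vert d → ℝ,
    (∀ x y, q' 0 x y = if x = y then (1:ℝ) else 0) →
    (∀ t x y, 0 ≤ q' t x y) →
    (∀ x y, ∀ t : ℝ, 0 ≤ t →
      HasDerivAt (fun s => q' s x y)
        (∑ z ∈ nbrs x, a x z / θ x * (q' t z y - q' t x y)) t) →
    ∀ t : ℝ, 0 ≤ t → ∀ x y, q t x y ≤ q' t x y)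

/-- The FPP edge weight `(1 ∧ (κ(x) ∧ κ(y))/a(x,y))^{1/2}` (equal to `∞` on closed
edges); used both for the metric `d_κ` and, with `θ` in place of `κ`, for `d_θ`. -/
noncomputable def kapWeightE {d : ℕ} (a : Vert d → Vert d → ℝ) (κ : Vert d → ℝ)
    (x y : Vert d) : ℝ≥0∞ :=
  if 0 < a x y then ENNReal.ofReal (Real.sqrt (min 1 (min (κ x) (κ y) / a x y))) else ∞

/-- The FPP-type metric `d_κ` on the open cluster. -/
noncomputable def dkap {d : ℕ} (a : Vert d → Vert d → ℝ) (κ : Vert d → ℝ)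
    (x y : Vert d) : ℝ≥0∞ :=
  ⨅ p : {p : List (Vert d) // IsOpenPath a x y p},
    ((edgesOf p.1).map fun e => kapWeightE a κ e.1 e.2).sum

/-- `F_γ(r) = (1+r)^γ (1+1/r)^{1/2}` in `ℝ≥0∞` (so `F_γ(0) = ∞`). -/
noncomputable def FgamE (γ r : ℝ) : ℝ≥0∞ :=
  (1 + ENNReal.ofReal r) ^ γ * (1 + (ENNReal.ofReal r)⁻¹) ^ ((1:ℝ) / 2)

/-- The open cluster of `x` has `ℓ^1`-diameter at least `r`. -/
def clusterDiamGE {d : ℕ} (a : Vert d → Vert d → ℝ) (x : Vert d) (r : ℝ) : Prop :=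
  ∃ y z, openConn a x y ∧ openConn a x z ∧ r ≤ (l1Dist y z : ℝ)

/-- Condition **S1** (local uniqueness of large clusters). -/
def CondS1 {d : ℕ} {Γ : Type*} [MeasurableSpace Γ]
    (P : ℝ → Measure (Config d Γ)) (I : Set ℝ)
    (aC : Config d Γ → Vert d → Vert d → ℝ) : Prop :=
  ∃ fS : ℝ → ℕ → ℝ, ∀ u ∈ I, ∃ ΔS RS : ℝ, 0 < ΔS ∧
    (∀ R : ℕ, RS ≤ R → Real.log (R : ℝ) ^ (1 + ΔS) ≤ fS u R) ∧
    ∀ R : ℕ, 1 ≤ R →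
      (ENNReal.ofReal (1 - Real.exp (-(fS u R))) ≤
        P u {ω | ∃ x ∈ cubeVerts (0 : Vert d) (R : ℝ), clusterDiamGE (aC ω) x (R : ℝ)}) ∧
      (ENNReal.ofReal (1 - Real.exp (-(fS u R))) ≤
        P u {ω | ∀ x ∈ cubeVerts (0 : Vert d) (R : ℝ), ∀ y ∈ cubeVerts (0 : Vert d) (R : ℝ),
          clusterDiamGE (aC ω) x ((R : ℝ) / 10) → clusterDiamGE (aC ω) y ((R : ℝ) / 10) →
          ∃ p, IsOpenPath (aC ω) x y p ∧ ∀ v ∈ p, v ∈ cubeVerts (0 : Vert d) ((2 * R : ℕ) : ℝ)})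

/-- Condition **S2**: `u ↦ P^u(0 ∈ C_∞)` is positive and continuous on `I`. -/
def CondS2 {d : ℕ} {Γ : Type*} [MeasurableSpace Γ]
    (P : ℝ → Measure (Config d Γ)) (I : Set ℝ)
    (aC : Config d Γ → Vert d → Vert d → ℝ) : Prop :=
  (∀ u ∈ I, 0 < P u {ω | (0 : Vert d) ∈ Cinf (aC ω)}) ∧
  ContinuousOn (fun u => (P u {ω | (0 : Vert d) ∈ Cinf (aC ω)}).toReal) I

/-- Weighted `p`-th moment `E[X^p w]` (essential supremum of `X` for `p = ∞`). -/
noncomputable def wMoment {Ω : Type*} [MeasurableSpace Ω] (μm : Measure Ω) (p : ℝ≥0∞)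
    (X w : Ω → ℝ≥0∞) : ℝ≥0∞ :=
  if p = ∞ then essSup X μm else ∫⁻ ω, X ω ^ p.toReal * w ω ∂μm

/-- `p_* = p/(p-1)` (with `∞_* = 1`). -/
noncomputable def pstar (p : ℝ≥0∞) : ℝ≥0∞ :=
  if p = ∞ then 1 else ENNReal.ofReal (p.toReal / (p.toReal - 1))

/-- `‖∇η‖_{ℓ^∞(E)}`: the supremum of `|η(y)-η(x)|` over open edges. -/
noncomputable def gradSup {d : ℕ} (a : Vert d → Vert d → ℝ) (η : Vert d → ℝ) : ℝ :=
  sSup {r : ℝ | ∃ x y, openAdj a x y ∧ r = |η y - η x|}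

/-- `exp(-ζ x)` for `x ∈ ℝ≥0∞` (equal to `0` at `x = ∞`). -/
noncomputable def expNegE (ζ : ℝ) (x : ℝ≥0∞) : ℝ≥0∞ :=
  if x = ∞ then 0 else ENNReal.ofReal (Real.exp (-(ζ * x.toReal)))

/-- The `m^ω(n)` factor of the maximal inequality. -/
noncomputable def mBound {d : ℕ} (a : Vert d → Vert d → ℝ) (p q : ℝ≥0∞)
    (phi : Vert d → ℝ) (x0 : Vert d) (n : ℕ) : ℝ :=
  avgNormR p (ballCh a x0 (n : ℝ)) (fun x => max 1 (muA a x)) *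
    avgNormR q (ballCh a x0 (n : ℝ)) (fun x => max 1 (nuA a x)) *
    (1 + avgNormR p (ballCh a x0 (n : ℝ)) (carre a phi fun z => (phi z)⁻¹) * (n : ℝ) ^ 2)

/-- The Caccioppoli estimate with constant `c35` (for the data `a`, `κ`, `h`). -/
def CaccEst {d : ℕ} (a : Vert d → Vert d → ℝ) (κ : Vert d → ℝ) (h : ℝ) (c35 : ℝ) :
    Prop :=
  ∀ B : Set (Vert d), B.Finite → B ⊆ Cinf a →
    (∀ x ∈ B, ∀ y ∈ B, ∃ p, IsOpenPath a x y p ∧ ∀ v ∈ p, v ∈ B) →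
  ∀ η : Vert d → ℝ, (∀ x, η x ∈ Set.Icc (0:ℝ) 1) → (∀ x, η x ≠ 0 → x ∈ B) →
    (∀ x ∈ B, (∃ y, y ∉ B ∧ openAdj a x y) → η x = 0) →
  ∀ u : Vert d → ℝ, (∀ x, 0 ≤ u x) → (∀ x ∈ B, 0 ≤ genL a κ h u x) →
  ∀ phi : Vert d → ℝ, (∀ x, 0 < phi x) →
  ∀ α : ℝ, 1 ≤ α →
    dirichletE a κ h (fun x => η x * (phi x * u x) ^ α) ≤
      c35 * α ^ 2 * ∑' x, (phi x * u x) ^ (2 * α) *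
        (carre a η η x - carreEta a η phi (fun z => (phi z)⁻¹) x)


/-- Proposition `Prop:condformu=0`: for stationary ergodic
integrable edge weights, if the probability that `0` is connected to `nx` by a
path of zero-weight edges stays bounded away from `0`, then the time constant
`μ_u(x)` vanishes. -/
theorem statement0
    {d : ℕ} (hd : 2 ≤ d)
    {Ω : Type*} [MeasurableSpace Ω]
    (P : Measure Ω) [IsProbabilityMeasure P]
    (t : Ω → Vert d → Vert d → ℝ≥0∞)
    (htmeas : ∀ x y, Measurable fun ω => t ω x y)
    (htsymm : ∀ ω x y, t ω x y = t ω y x)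
    -- stationarity and ergodicity of the weights, via a family of shifts `τ`
    (τ : Vert d → Ω → Ω)
    (hτshift : ∀ z ω x y, t (τ z ω) x y = t ω (x + z) (y + z))
    (hτinv : ∀ z, MeasurePreserving (τ z) P P)
    (herg : ∀ A : Set Ω, MeasurableSet A → (∀ z, τ z ⁻¹' A = A) → P A = 0 ∨ P A = 1)
    -- integrability: `E^u[t_e] < ∞` for every edge
    (hint : ∀ x y, adj x y → ∫⁻ ω, t ω x y ∂P ≠ ∞)
    (x : Vert d) (hx : x ≠ 0)
    -- the time constant `μ_u(x)` (whose existence is guaranteed by Kingman's theorem)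
    (μ : ℝ≥0∞)
    (hμ : ∀ᵐ ω ∂P,
      Tendsto (fun n : ℕ => fppDist (t ω) 0 (n • x) / (n : ℝ≥0∞)) atTop (𝓝 μ))
    -- `lim_n P(0 ↔ nx in {e : t_e = 0}) = L > 0`
    (L : ℝ≥0∞) (hL : 0 < L)
    (hlim : Tendsto
      (fun n : ℕ => P {ω | ConnectedIn (zeroSet (t ω)) 0 (n • x)}) atTop (𝓝 L)) :
    μ = 0 := by
  by_contra hne
  have hmeas : ∀ n : ℕ, MeasurableSet {ω | ConnectedIn (zeroSet (t ω)) 0 (n • x)} := by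
    intro n
    have h1 : {ω | ConnectedIn (zeroSet (t ω)) 0 (n • x)} =
        ⋃ p : List (Vert d), {ω | IsPathFrom 0 (n • x) p ∧
          ∀ e ∈ (edgesOf p).toFinset, adj e.1 e.2 ∧ t ω e.1 e.2 = 0} := by
      ext ω
      simp [ConnectedIn, zeroSet]
    rw [h1]
    refine MeasurableSet.iUnion fun p => ?_
    refine (MeasurableSet.const _).inter ?_
    have h2 : {ω | ∀ e ∈ (edgesOf p).toFinset, adj e.1 e.2 ∧ t ω e.1 e.2 = 0} =
        ⋂ e ∈ (edgesOf p).toFinset, {ω | adj e.1 e.2 ∧ t ω e.1 e.2 = 0} := by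
      ext ω
      simp only [Set.mem_setOf_eq, Set.mem_iInter]
    show MeasurableSet {ω | ∀ e ∈ (edgesOf p).toFinset, adj e.1 e.2 ∧ t ω e.1 e.2 = 0}
    rw [h2]
    refine Finset.measurableSet_biInter _ fun e _ => ?_
    exact (MeasurableSet.const _).inter (htmeas e.1 e.2 (measurableSet_singleton 0))
  have hzero : ∀ (w : Vert d → Vert d → ℝ≥0∞) (y : Vert d),
      ConnectedIn (zeroSet w) 0 y → fppDist w 0 y = 0 := by
    rintro w y ⟨p, hp, he⟩
    refine le_antisymm ?_ bot_le
    refine (iInf_le _ (⟨p, hp⟩ : {p : List (Vert d) // IsPathFrom 0 y p})).trans ?_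
    refine le_of_eq ?_
    refine List.sum_eq_zero ?_
    intro r hr
    obtain ⟨e, hem, rfl⟩ := List.mem_map.1 hr
    exact (he e hem).2
  have hev : ∀ᵐ ω ∂P, ∀ᶠ n : ℕ in atTop,
      ω ∈ {ω | ConnectedIn (zeroSet (t ω)) 0 (n • x)} ↔ ω ∈ (∅ : Set Ω) := by
    filter_upwards [hμ] with ω hω
    filter_upwards [hω.eventually (lt_mem_nhds (pos_iff_ne_zero.2 hne))] with n hn
    simp only [Set.mem_setOf_eq, Set.mem_empty_iff_false, iff_false]
    intro hc
    rw [hzero _ _ hc] at hn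
    simp at hn
  have h0 : Tendsto (fun n : ℕ => P {ω | ConnectedIn (zeroSet (t ω)) 0 (n • x)})
      atTop (𝓝 (P ∅)) :=
    tendsto_measure_of_ae_tendsto_indicator_of_isFiniteMeasure atTop
      MeasurableSet.empty hmeas hev
  rw [measure_empty] at h0
  exact hL.ne' (tendsto_nhds_unique hlim h0)

end FPPPaper
end

section
/- Let d ≥ 3. Suppose the infinite cluster (C_∞(ω), O(ω)) satisfies the graph assumption, and that there exist p, q ∈ (1,∞] with 1/p + 1/q < 2/d' such that for every x ∈ C_∞(ω) there exists N_7(ω,x) with sup_{n ≥ N_7(ω,x)} max{ ‖μ^ω‖_{p,B^ω(x,n)}, ‖ν^ω‖_{q,B^ω(x,n)} } ≤ C_int for some C_int < ∞. Then for any x ∈ C_∞(ω) there exist c_{21} ∈ (0,∞) and N_7(ω,x) such that for all y ∈ C_∞(ω) with ρ^ω(x,y) ≥ N_7(ω,x): g^ω(x,y) ≤ c_{21} ρ^ω(x,y)^{2−d}, where g^ω(x,y) = ∫_0^∞ p_θ^ω(t,x,y) dt is the Green kernel of the random walk among the conductances a^ω (without killing; it is independent of the speed measure). -/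
open MeasureTheory Filter ENNReal Topology
open scoped Classical

namespace FPPPaper

section Abstract
variable {V : Type}

/-- ordered energy -/
noncomputable def En (Λ : Finset V) (c : V → V → ℝ) (f : V → ℝ) : ℝ :=
  ∑ y ∈ Λ, ∑ z ∈ Λ, c y z * (f y - f z) ^ 2

lemma sum_symm_half (Λ : Finset V) (F G : V → V → ℝ)
    (h : ∀ y z, F y z + F z y = G y z + G z y) :
    ∑ y ∈ Λ, ∑ z ∈ Λ, F y z = ∑ y ∈ Λ, ∑ z ∈ Λ, G y z := by
  have h1 : ∑ y ∈ Λ, ∑ z ∈ Λ, (F y z + F z y) = ∑ y ∈ Λ, ∑ z ∈ Λ, (G y z + G z y) := by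
    simp only [h]
  simp only [Finset.sum_add_distrib] at h1
  rw [Finset.sum_comm (f := fun y z => F z y), Finset.sum_comm (f := fun y z => G z y)] at h1
  linarith

lemma sum_symm_half_le (Λ : Finset V) (F G : V → V → ℝ)
    (h : ∀ y ∈ Λ, ∀ z ∈ Λ, F y z + F z y ≤ G y z + G z y) :
    ∑ y ∈ Λ, ∑ z ∈ Λ, F y z ≤ ∑ y ∈ Λ, ∑ z ∈ Λ, G y z := by
  have h1 : ∑ y ∈ Λ, ∑ z ∈ Λ, (F y z + F z y) ≤ ∑ y ∈ Λ, ∑ z ∈ Λ, (G y z + G z y) :=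
    Finset.sum_le_sum fun y hy => Finset.sum_le_sum fun z hz => h y hy z hz
  simp only [Finset.sum_add_distrib] at h1
  rw [Finset.sum_comm (f := fun y z => F z y), Finset.sum_comm (f := fun y z => G z y)] at h1
  linarith

lemma sbp (Λ : Finset V) (c : V → V → ℝ) (hc : ∀ y z, c y z = c z y) (f h : V → ℝ) :
    ∑ y ∈ Λ, ∑ z ∈ Λ, c y z * (f y - f z) * (h y - h z)
      = 2 * ∑ y ∈ Λ, h y * ∑ z ∈ Λ, c y z * (f y - f z) := by
  simp only [Finset.mul_sum]
  apply sum_symm_half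
  intro y z
  rw [hc z y]; ring

lemma caccioppoli (Λ : Finset V) (c : V → V → ℝ) (hc : ∀ y z, c y z = c z y) (η v : V → ℝ)
    (h : ∀ y ∈ Λ, η y ^ 2 * v y * ∑ z ∈ Λ, c y z * (v y - v z) ≤ 0) :
    En Λ c (fun y => η y * v y) ≤
      ∑ y ∈ Λ, ∑ z ∈ Λ, c y z * ((η y - η z) ^ 2 * (v y * v z)) := by
  have h1 := sbp Λ c hc v (fun y => η y ^ 2 * v y)
  have h2 := Finset.sum_nonpos h
  have h3 : En Λ c (fun y => η y * v y) =
      ∑ y ∈ Λ, ∑ z ∈ Λ, c y z * (v y - v z) * (η y ^ 2 * v y - η z ^ 2 * v z) +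
      ∑ y ∈ Λ, ∑ z ∈ Λ, c y z * ((η y - η z) ^ 2 * (v y * v z)) := by
    unfold En
    rw [← Finset.sum_add_distrib]
    refine Finset.sum_congr rfl fun y _ => ?_
    rw [← Finset.sum_add_distrib]
    refine Finset.sum_congr rfl fun z _ => ?_
    ring
  linarith

lemma cacc_bound (Λ : Finset V) (c : V → V → ℝ) (hc : ∀ y z, c y z = c z y)
    (hc0 : ∀ y z, 0 ≤ c y z) (η v : V → ℝ) (G : ℝ) (A : V → Prop) [DecidablePred A]
    (hη : ∀ y z, 0 < c y z → |η y - η z| ≤ G)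
    (hA : ∀ y z, 0 < c y z → η y ≠ η z → A y)
    (h : ∀ y ∈ Λ, η y ^ 2 * v y * ∑ z ∈ Λ, c y z * (v y - v z) ≤ 0) :
    En Λ c (fun y => η y * v y) ≤
      G ^ 2 * ∑ y ∈ Λ, (∑ z ∈ Λ, c y z) * (if A y then v y ^ 2 else 0) := by
  refine (caccioppoli Λ c hc η v h).trans ?_
  have : G ^ 2 * ∑ y ∈ Λ, (∑ z ∈ Λ, c y z) * (if A y then v y ^ 2 else 0) =
      ∑ y ∈ Λ, ∑ z ∈ Λ, c y z * (G ^ 2 * (if A y then v y ^ 2 else 0)) := by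
    rw [Finset.mul_sum]
    refine Finset.sum_congr rfl fun y _ => ?_
    rw [← Finset.sum_mul]; ring
  rw [this]
  apply sum_symm_half_le
  intro y _ z _
  rw [hc z y]
  rcases (hc0 y z).eq_or_lt with h0 | h0
  · rw [← h0]; simp
  · rw [← mul_add, ← mul_add]
    apply mul_le_mul_of_nonneg_left _ h0.le
    by_cases he : η y = η z
    · rw [he]; simp
      positivity
    · have a1 := hA y z h0 he
      have a2 := hA z y (by rwa [hc z y]) (Ne.symm he)
      simp only [a1, a2, if_true]
      have h5 : (η y - η z) ^ 2 ≤ G ^ 2 := by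
        rw [← sq_abs]; exact pow_le_pow_left₀ (abs_nonneg _) (hη y z h0) 2
      have h6 : (η y - η z) ^ 2 * (v y ^ 2 + v z ^ 2) ≤ G ^ 2 * (v y ^ 2 + v z ^ 2) :=
        mul_le_mul_of_nonneg_right h5 (by positivity)
      have h7 : (η y - η z) ^ 2 * (2 * (v y * v z)) ≤ (η y - η z) ^ 2 * (v y ^ 2 + v z ^ 2) :=
        mul_le_mul_of_nonneg_left (by nlinarith [sq_nonneg (v y - v z)]) (by positivity)
      nlinarith

/-- energy of a truncation, general form -/
lemma trunc_energy (Λ : Finset V) (c : V → V → ℝ) (hc : ∀ y z, c y z = c z y)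
    (hc0 : ∀ y z, 0 ≤ c y z) (u w : V → ℝ)
    (hw : ∀ y z, (w y - w z) ^ 2 ≤ (u y - u z) * (w y - w z)) :
    En Λ c w ≤ 2 * ∑ y ∈ Λ, w y * ∑ z ∈ Λ, c y z * (u y - u z) := by
  rw [← sbp Λ c hc u w]
  refine Finset.sum_le_sum fun y _ => Finset.sum_le_sum fun z _ => ?_
  rw [mul_assoc]
  exact mul_le_mul_of_nonneg_left (hw y z) (hc0 y z)

lemma trunc_min (S a b : ℝ) : (min a S - min b S) ^ 2 ≤ (a - b) * (min a S - min b S) := by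
  rcases le_total a S with h1 | h1 <;> rcases le_total b S with h2 | h2 <;>
    simp only [min_eq_left h1, min_eq_right h1, min_eq_left h2, min_eq_right h2] <;> nlinarith

lemma trunc_max (S a b : ℝ) :
    (max (a - S) 0 - max (b - S) 0) ^ 2 ≤ (a - b) * (max (a - S) 0 - max (b - S) 0) := by
  rcases le_total (a - S) 0 with h1 | h1 <;> rcases le_total (b - S) 0 with h2 | h2 <;>
    simp only [max_eq_left h1, max_eq_right h1, max_eq_left h2, max_eq_right h2] <;> nlinarith

lemma rpow_sub_le {τ : ℝ} (hτ : 1 ≤ τ) {s t : ℝ} (hs : 0 ≤ s) (ht : 0 ≤ t) :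
    |s ^ τ - t ^ τ| ≤ τ * (s ^ (τ - 1) + t ^ (τ - 1)) * |s - t| := by
  have key : ∀ s t : ℝ, 0 ≤ t → t ≤ s → s ^ τ - t ^ τ ≤ τ * s ^ (τ - 1) * (s - t) := by
    intro s t ht hts
    have hs : 0 ≤ s := ht.trans hts
    rcases hts.eq_or_lt with h | h
    · rw [h]; simp
    have hcv := (convexOn_rpow hτ)
    have h1 := hcv.slope_le_of_hasDerivAt (x := t) (y := s) ht hs h
      (Real.hasDerivAt_rpow_const (Or.inr hτ))
    rw [slope_def_field, div_le_iff₀ (by linarith)] at h1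
    exact h1
  have hs1 : 0 ≤ s ^ (τ - 1) := Real.rpow_nonneg hs _
  have ht1 : 0 ≤ t ^ (τ - 1) := Real.rpow_nonneg ht _
  rcases le_total t s with h | h
  · have := key s t ht h
    have h2 : t ^ τ ≤ s ^ τ := Real.rpow_le_rpow ht h (by linarith)
    rw [abs_of_nonneg (by linarith), abs_of_nonneg (by linarith)]
    refine this.trans (mul_le_mul_of_nonneg_right ?_ (by linarith))
    nlinarith
  · have := key t s hs h
    have h2 : s ^ τ ≤ t ^ τ := Real.rpow_le_rpow hs h (by linarith)
    rw [abs_of_nonpos (by linarith), abs_of_nonpos (by linarith)]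
    have : t ^ τ - s ^ τ ≤ τ * (s ^ (τ - 1) + t ^ (τ - 1)) * (t - s) := by
      refine this.trans (mul_le_mul_of_nonneg_right ?_ (by linarith))
      nlinarith
    linarith

/-- Hölder in averaged form -/
lemma holder_avg (B : Finset V) (p : ℝ) (hp : 1 < p) (f h : V → ℝ) (N C : ℝ) (hN : 0 < N) (hC : 0 ≤ C)
    (hf : ∀ y ∈ B, 0 ≤ f y) (hh : ∀ y ∈ B, 0 ≤ h y)
    (hfC : ∑ y ∈ B, f y ^ p ≤ C ^ p * N) :
    ∑ y ∈ B, f y * h y ≤ C * N * ((∑ y ∈ B, h y ^ (p / (p - 1))) / N) ^ ((p - 1) / p) := by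
  have hpq : p.HolderConjugate (p / (p - 1)) := Real.HolderConjugate.conjExponent hp
  have h1 := Real.inner_le_Lp_mul_Lq_of_nonneg B hpq hf hh
  refine h1.trans ?_
  have hp0 : 0 < p := by linarith
  have hH : 0 ≤ ∑ y ∈ B, h y ^ (p / (p - 1)) :=
    Finset.sum_nonneg fun y hy => Real.rpow_nonneg (hh y hy) _
  have h2 : (∑ y ∈ B, f y ^ p) ^ (1 / p) ≤ C * N ^ (1 / p) := by
    calc _ ≤ (C ^ p * N) ^ (1 / p) := Real.rpow_le_rpow
          (Finset.sum_nonneg fun y hy => Real.rpow_nonneg (hf y hy) _) hfC (by positivity)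
      _ = C * N ^ (1 / p) := by
          rw [Real.mul_rpow (by positivity) hN.le, ← Real.rpow_mul hC]
          rw [mul_one_div_cancel hp0.ne', Real.rpow_one]
  have h3 : (1 : ℝ) / (p / (p - 1)) = (p - 1) / p := by field_simp
  rw [h3, Real.div_rpow hH hN.le]
  have h4 : N = N ^ (1 / p) * N ^ ((p - 1) / p) := by
    rw [← Real.rpow_add hN]
    have : 1 / p + (p - 1) / p = 1 := by field_simp; ring
    rw [this, Real.rpow_one]
  have h5 : 0 < N ^ ((p - 1) / p) := Real.rpow_pos_of_pos hN _
  calc _ ≤ C * N ^ (1 / p) * (∑ y ∈ B, h y ^ (p / (p - 1))) ^ ((p - 1) / p) :=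
        mul_le_mul_of_nonneg_right h2 (Real.rpow_nonneg hH _)
    _ = C * (N ^ (1 / p) * N ^ ((p - 1) / p)) *
        ((∑ y ∈ B, h y ^ (p / (p - 1))) ^ ((p - 1) / p) / N ^ ((p - 1) / p)) := by
        field_simp
    _ = _ := by rw [← h4]

end Abstract

section Abstract2
variable {V : Type}

/-- abstract `ℓ¹`-Sobolev inequality -/
def Sob (Λ B : Finset V) (c : V → V → ℝ) (σ A : ℝ) : Prop :=
  ∀ F : V → ℝ, (∀ y, 0 ≤ F y) → (∀ y, y ∉ B → F y = 0) →
    ((∑ y ∈ B, F y ^ σ) / (B.card : ℝ)) ^ (1 / σ) ≤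
      A * (1 / 2 * ∑ y ∈ Λ, ∑ z ∈ Λ, if 0 < c y z then |F y - F z| else 0)

lemma grad_pow_bound (Λ B : Finset V) (hBΛ : B ⊆ Λ) (c : V → V → ℝ) (hc : ∀ y z, c y z = c z y)
    (hc0 : ∀ y z, 0 ≤ c y z) (τ : ℝ) (hτ : 1 < τ) (f : V → ℝ) (hf : ∀ y, 0 ≤ f y)
    (hfB : ∀ y, y ∉ B → f y = 0) :
    (1 / 2 * ∑ y ∈ Λ, ∑ z ∈ Λ, if 0 < c y z then |f y ^ τ - f z ^ τ| else 0) ^ 2 ≤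
      τ ^ 2 * (En Λ c f * ∑ y ∈ B, (∑ z ∈ Λ, (c y z)⁻¹) * (f y ^ (τ - 1)) ^ 2) := by
  set X : V → V → ℝ := fun y z => if 0 < c y z then f y ^ (τ - 1) * |f y - f z| else 0 with hX
  have h1 : (1 / 2 * ∑ y ∈ Λ, ∑ z ∈ Λ, if 0 < c y z then |f y ^ τ - f z ^ τ| else 0) ≤
      τ * ∑ y ∈ Λ, ∑ z ∈ Λ, X y z := by
    simp only [Finset.mul_sum]
    apply sum_symm_half_le
    intro y _ z _
    simp only [hX]
    rw [hc z y]
    by_cases h0 : 0 < c y z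
    · simp only [h0, if_true]
      have := rpow_sub_le hτ.le (hf y) (hf z)
      rw [abs_sub_comm (f z ^ τ), abs_sub_comm (f z)]
      nlinarith
    · simp [h0]
  have h0 : 0 ≤ (1 / 2 * ∑ y ∈ Λ, ∑ z ∈ Λ, if 0 < c y z then |f y ^ τ - f z ^ τ| else 0) := by
    refine mul_nonneg (by norm_num) (Finset.sum_nonneg fun y _ => Finset.sum_nonneg fun z _ => ?_)
    split_ifs <;> positivity
  refine (pow_le_pow_left₀ h0 h1 2).trans ?_
  rw [mul_pow]
  refine mul_le_mul_of_nonneg_left ?_ (by positivity)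
  have h2 : ∑ y ∈ Λ, ∑ z ∈ Λ, X y z = ∑ e ∈ Λ ×ˢ Λ,
      (Real.sqrt (c e.1 e.2) * |f e.1 - f e.2|) * (Real.sqrt (c e.1 e.2)⁻¹ * f e.1 ^ (τ - 1)) := by
    rw [Finset.sum_product]
    refine Finset.sum_congr rfl fun y _ => Finset.sum_congr rfl fun z _ => ?_
    simp only [hX]
    by_cases h0 : 0 < c y z
    · simp only [h0, if_true]
      rw [Real.sqrt_inv]
      have : Real.sqrt (c y z) ≠ 0 := (Real.sqrt_pos.mpr h0).ne'
      field_simp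
    · have : c y z = 0 := le_antisymm (not_lt.mp h0) (hc0 y z)
      simp [this]
  rw [h2]
  refine (Finset.sum_mul_sq_le_sq_mul_sq _ _ _).trans (le_of_eq ?_)
  congr 1
  · rw [Finset.sum_product]; unfold En
    refine Finset.sum_congr rfl fun y _ => Finset.sum_congr rfl fun z _ => ?_
    rw [mul_pow, Real.sq_sqrt (hc0 y z), sq_abs]
  · rw [Finset.sum_product]
    rw [← Finset.sum_subset hBΛ (f := fun y => ∑ z ∈ Λ, (Real.sqrt (c y z)⁻¹ * f y ^ (τ - 1)) ^ 2)]
    · refine Finset.sum_congr rfl fun y _ => ?_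
      rw [Finset.sum_mul]
      refine Finset.sum_congr rfl fun z _ => ?_
      rw [mul_pow, Real.sq_sqrt (inv_nonneg.mpr (hc0 y z))]
    · intro y _ hy
      rw [hfB y hy, Real.zero_rpow (by linarith)]; simp

lemma sobL2 (Λ B : Finset V) (hBΛ : B ⊆ Λ) (hB : B.Nonempty) (c : V → V → ℝ)
    (hc : ∀ y z, c y z = c z y)
    (hc0 : ∀ y z, 0 ≤ c y z) (σ q r A Cν : ℝ) (hσ : 0 < σ) (hq : 1 < q) (hA : 0 ≤ A) (hCν : 0 ≤ Cν)
    (hr : 0 < r) (hσr : σ < r)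
    (hrel : 1 / r = 1 / σ - (q - 1) / (2 * q))
    (hν : ∑ y ∈ B, (∑ z ∈ Λ, (c y z)⁻¹) ^ q ≤ Cν ^ q * B.card)
    (hS : Sob Λ B c σ A) (f : V → ℝ) (hf : ∀ y, 0 ≤ f y) (hfB : ∀ y, y ∉ B → f y = 0) :
    ((∑ y ∈ B, f y ^ r) / (B.card : ℝ)) ^ (2 / r) ≤
      (A * (r / σ)) ^ 2 * Cν * B.card * En Λ c f := by
  have hN : (0 : ℝ) < B.card := by exact_mod_cast hB.card_pos
  set N : ℝ := (B.card : ℝ) with hNd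
  set τ := r / σ with hτd
  have hτ : 1 < τ := by rw [hτd, lt_div_iff₀ hσ]; linarith
  set Φ := (∑ y ∈ B, f y ^ r) / N with hΦd
  have hΦ0 : 0 ≤ Φ := div_nonneg (Finset.sum_nonneg fun y _ => Real.rpow_nonneg (hf y) _) hN.le
  have hE : 0 ≤ En Λ c f := Finset.sum_nonneg fun y _ => Finset.sum_nonneg fun z _ =>
    mul_nonneg (hc0 y z) (sq_nonneg _)
  have h1 := hS (fun y => f y ^ τ) (fun y => Real.rpow_nonneg (hf y) _)
    (fun y hy => by rw [hfB y hy, Real.zero_rpow (by linarith)])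
  have e1 : ∑ y ∈ B, (f y ^ τ) ^ σ = ∑ y ∈ B, f y ^ r := by
    refine Finset.sum_congr rfl fun y _ => ?_
    rw [← Real.rpow_mul (hf y), hτd, div_mul_cancel₀ _ hσ.ne']
  rw [e1] at h1
  have h2 := grad_pow_bound Λ B hBΛ c hc hc0 τ hτ f hf hfB
  have h3 := holder_avg B q hq (fun y => ∑ z ∈ Λ, (c y z)⁻¹) (fun y => (f y ^ (τ - 1)) ^ 2)
    N Cν hN hCν (fun y _ => Finset.sum_nonneg fun z _ => inv_nonneg.mpr (hc0 y z))
    (fun y _ => sq_nonneg _) hν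
  have e2 : (τ - 1) * 2 * (q / (q - 1)) = r := by
    have hq1 : q - 1 ≠ 0 := by linarith
    have hq0 : q ≠ 0 := by linarith
    have : 2 * r / σ - 2 = r * ((q - 1) / q) := by
      have : 2 * r * (1 / r) = 2 * r * (1 / σ - (q - 1) / (2 * q)) := by rw [hrel]
      field_simp at this ⊢
      linarith
    have e : (τ - 1) * 2 = r * ((q - 1) / q) := by rw [← this, hτd]; ring
    rw [e]; field_simp
  have e3 : ∑ y ∈ B, ((f y ^ (τ - 1)) ^ 2) ^ (q / (q - 1)) = ∑ y ∈ B, f y ^ r := by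
    refine Finset.sum_congr rfl fun y _ => ?_
    rw [← Real.rpow_natCast, ← Real.rpow_mul (hf y), ← Real.rpow_mul (hf y)]
    norm_num [e2]
  rw [e3, ← hΦd] at h3
  rcases hΦ0.eq_or_lt with h | hΦ
  · rw [← h, Real.zero_rpow (by positivity)]
    positivity
  have h4 : (Φ ^ (1 / σ)) ^ 2 ≤ A ^ 2 * (τ ^ 2 * (En Λ c f * (Cν * N * Φ ^ ((q - 1) / q)))) := by
    refine (pow_le_pow_left₀ (Real.rpow_nonneg hΦ0 _) h1 2).trans ?_
    rw [mul_pow]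
    refine mul_le_mul_of_nonneg_left (h2.trans ?_) (by positivity)
    exact mul_le_mul_of_nonneg_left (mul_le_mul_of_nonneg_left h3 hE) (by positivity)
  have e4 : (Φ ^ (1 / σ)) ^ 2 = Φ ^ (2 / r) * Φ ^ ((q - 1) / q) := by
    rw [← Real.rpow_natCast, ← Real.rpow_mul hΦ0, ← Real.rpow_add hΦ]
    congr 1
    have : 2 / r = 2 * (1 / r) := by ring
    rw [this, hrel]; push_cast
    field_simp; ring
  rw [e4] at h4
  have hpos : 0 < Φ ^ ((q - 1) / q) := Real.rpow_pos_of_pos hΦ _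
  refine le_of_mul_le_mul_right (h4.trans (le_of_eq ?_)) hpos
  ring

end Abstract2

lemma fast_decay (E0 Q ε b c : ℝ) (J : ℕ) (X : ℕ → ℝ) (hE : 0 < E0) (hQ : 0 ≤ Q) (hε : 0 < ε)
    (hb : 0 < b) (hc : 0 < c) (hQb : Q ≤ b ^ ε) (hcE : E0 * c ^ ε * b ≤ 1) (hX : ∀ j, 0 ≤ X j)
    (hX0 : X 0 ≤ c) (hstep : ∀ j, j < J → X (j + 1) ≤ E0 * Q ^ j * X j ^ (1 + ε)) :
    ∀ j, j ≤ J → X j ≤ c / b ^ j := by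
  intro j
  induction j with
  | zero => intro _; simpa using hX0
  | succ j ih =>
    intro hj
    have h1 := ih (by omega)
    have hbj : 0 < b ^ j := by positivity
    have hcb : 0 < c / b ^ j := by positivity
    refine (hstep j (by omega)).trans ?_
    have h2 : X j ^ (1 + ε) ≤ (c / b ^ j) ^ (1 + ε) := Real.rpow_le_rpow (hX j) h1 (by linarith)
    have h3 : (c / b ^ j) ^ (1 + ε) = (c / b ^ j) * (c ^ ε / (b ^ ε) ^ j) := by
      rw [Real.rpow_add hcb, Real.rpow_one, Real.div_rpow hc.le hbj.le]
      congr 2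
      rw [← Real.rpow_natCast, ← Real.rpow_natCast, ← Real.rpow_mul hb.le, ← Real.rpow_mul hb.le,
        mul_comm]
    have hbe : 0 < b ^ ε := Real.rpow_pos_of_pos hb _
    have h4 : Q ^ j ≤ (b ^ ε) ^ j := pow_le_pow_left₀ hQ hQb j
    have hce : 0 < c ^ ε := Real.rpow_pos_of_pos hc _
    calc E0 * Q ^ j * X j ^ (1 + ε) ≤ E0 * (b ^ ε) ^ j * ((c / b ^ j) * (c ^ ε / (b ^ ε) ^ j)) := by
          rw [← h3]
          exact mul_le_mul (mul_le_mul_of_nonneg_left h4 hE.le) h2 (Real.rpow_nonneg (hX j) _)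
            (by positivity)
      _ = (c / b ^ j) * (E0 * c ^ ε) := by field_simp
      _ ≤ (c / b ^ j) * (1 / b) := by
          refine mul_le_mul_of_nonneg_left ?_ hcb.le
          rw [le_div_iff₀ hb]; exact hcE
      _ = c / b ^ (j + 1) := by rw [pow_succ]; field_simp

section Abstract3
variable {V : Type}

lemma clamp_lip (s g : ℝ) (hg : 0 < g) (a b : ℝ) (h : |a - b| ≤ 1) :
    |min 1 (max 0 ((a - s) / g)) - min 1 (max 0 ((b - s) / g))| ≤ 1 / g := by
  refine (abs_min_sub_min_le_max _ _ _ _).trans ?_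
  have h1 := abs_max_sub_max_le_max 0 ((a - s) / g) 0 ((b - s) / g)
  have h2 : |(a - s) / g - (b - s) / g| ≤ 1 / g := by
    rw [← sub_div, abs_div, abs_of_pos hg]
    apply div_le_div_of_nonneg_right _ hg.le
    simpa using h
  have : 0 ≤ 1 / g := by positivity
  simp only [sub_self, abs_zero] at h1 ⊢
  exact max_le this (h1.trans (max_le this h2))

lemma dg_step (p r CS Cμ n : ℝ) (hp : 1 < p) (hr : 2 * (p / (p - 1)) < r)
    (hCS : 0 ≤ CS) (hCμ : 0 ≤ Cμ)
    (Λ B : Finset V) (hBΛ : B ⊆ Λ) (hB : B.Nonempty) (c : V → V → ℝ)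
    (hc : ∀ y z, c y z = c z y) (hc0 : ∀ y z, 0 ≤ c y z) (ρ : V → ℕ) (x : V) (u : V → ℝ)
    (hLip : ∀ y z, 0 < c y z → ρ y ≤ ρ z + 1) (hρx : ρ x = 0)
    (hμ : ∑ y ∈ B, (∑ z ∈ Λ, c y z) ^ p ≤ Cμ ^ p * B.card)
    (hSob : ∀ f : V → ℝ, (∀ y, 0 ≤ f y) → (∀ y, y ∉ B → f y = 0) →
      ((∑ y ∈ B, f y ^ r) / (B.card : ℝ)) ^ (2 / r) ≤ CS * n ^ 2 / B.card * En Λ c f)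
    (huB : ∀ y, y ∉ B → u y = 0)
    (huL : ∀ y ∈ B, ∑ z ∈ Λ, c y z * (u y - u z) = if y = x then 1 else 0)
    (s s' : ℕ) (hs : 1 ≤ s) (hss : s < s') (κ κ' : ℝ) (hκ : 0 ≤ κ) (hκκ : κ < κ') :
    (∑ y ∈ B, if s' ≤ ρ y then max (u y - κ') 0 ^ (2 * (p / (p - 1))) else 0) / (B.card : ℝ) ≤
      (1 / (κ' - κ)) ^ (r - 2 * (p / (p - 1))) *
        (CS * Cμ * (n / ((s' : ℝ) - s)) ^ 2 *
          ((∑ y ∈ B, if s ≤ ρ y then max (u y - κ) 0 ^ (2 * (p / (p - 1))) else 0)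
            / (B.card : ℝ)) ^ ((p - 1) / p)) ^ (r / 2) := by
  have hN : (0 : ℝ) < B.card := by exact_mod_cast hB.card_pos
  have hg : (0 : ℝ) < (s' : ℝ) - s := by
    have : (s : ℝ) < s' := by exact_mod_cast hss
    linarith
  set g : ℝ := (s' : ℝ) - s with hgd
  set β : ℝ := 2 * (p / (p - 1)) with hβd
  have hβ : 0 < β := by
    have : 0 < p - 1 := by linarith
    positivity
  have hr0 : 0 < r := hβ.trans hr
  set v : V → ℝ := fun y => max (u y - κ) 0 with hv
  set η : V → ℝ := fun y => min 1 (max 0 (((ρ y : ℝ) - s) / g)) with hη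
  have hv0 : ∀ y, 0 ≤ v y := fun y => le_max_right _ _
  have hη0 : ∀ y, 0 ≤ η y := fun y => le_min zero_le_one (le_max_left _ _)
  have hvB : ∀ y, y ∉ B → v y = 0 := fun y hy => by
    simp only [hv]; rw [huB y hy]; exact max_eq_right (by linarith)
  have hηz : ∀ y, ρ y ≤ s → η y = 0 := fun y hy => by
    have h1 : (ρ y : ℝ) ≤ s := by exact_mod_cast hy
    have : ((ρ y : ℝ) - s) / g ≤ 0 := div_nonpos_of_nonpos_of_nonneg (by linarith) hg.le
    simp only [hη]; rw [max_eq_left this]; simp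
  have hη1 : ∀ y, s' ≤ ρ y → η y = 1 := fun y hy => by
    have h1 : (s' : ℝ) ≤ ρ y := by exact_mod_cast hy
    have : 1 ≤ ((ρ y : ℝ) - s) / g := by rw [le_div_iff₀ hg]; linarith
    simp only [hη]; rw [min_eq_left (this.trans (le_max_right _ _))]
  have hcacc := cacc_bound Λ c hc hc0 η v (1 / g) (fun y => s ≤ ρ y)
    (by
      intro y z h0
      apply clamp_lip _ _ hg
      have a1 : (ρ y : ℝ) ≤ ρ z + 1 := by exact_mod_cast hLip y z h0
      have a2 : (ρ z : ℝ) ≤ ρ y + 1 := by exact_mod_cast hLip z y (by rwa [hc z y])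
      rw [abs_le]; constructor <;> linarith)
    (by
      intro y z h0 hne
      by_contra hlt
      have a2 := hLip z y (by rwa [hc z y])
      exact hne (by rw [hηz y (by omega), hηz z (by omega)]))
    (by
      intro y _
      by_cases hyB : y ∈ B
      swap
      · rw [hvB y hyB]; simp
      by_cases hyx : y = x
      · rw [hyx, hηz x (by omega)]; simp
      rcases (hv0 y).eq_or_lt with h | h
      · rw [← h]; simp
      have hvy : v y = u y - κ := by
        rcases le_total (u y - κ) 0 with h' | h'
        · simp only [hv] at h; rw [max_eq_right h'] at h; exact absurd h (lt_irrefl _)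
        · exact max_eq_left h'
      have : ∑ z ∈ Λ, c y z * (v y - v z) ≤ ∑ z ∈ Λ, c y z * (u y - u z) := by
        refine Finset.sum_le_sum fun z _ => mul_le_mul_of_nonneg_left ?_ (hc0 y z)
        have : u z - κ ≤ v z := le_max_left _ _
        linarith
      rw [huL y hyB, if_neg hyx] at this
      exact mul_nonpos_of_nonneg_of_nonpos (mul_nonneg (sq_nonneg _) (hv0 y)) this)
  have hsumB : ∑ y ∈ Λ, (∑ z ∈ Λ, c y z) * (if s ≤ ρ y then v y ^ 2 else 0) =
      ∑ y ∈ B, (∑ z ∈ Λ, c y z) * (if s ≤ ρ y then v y ^ 2 else 0) := by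
    symm
    apply Finset.sum_subset hBΛ
    intro y _ hy
    rw [hvB y hy]; simp
  have hH := holder_avg B p hp (fun y => ∑ z ∈ Λ, c y z) (fun y => if s ≤ ρ y then v y ^ 2 else 0)
    B.card Cμ hN hCμ (fun y _ => Finset.sum_nonneg fun z _ => hc0 y z)
    (fun y _ => by split_ifs <;> positivity) hμ
  have e1 : ∑ y ∈ B, (if s ≤ ρ y then v y ^ 2 else 0) ^ (p / (p - 1)) =
      ∑ y ∈ B, if s ≤ ρ y then v y ^ β else 0 := by
    refine Finset.sum_congr rfl fun y _ => ?_
    split_ifs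
    · rw [← Real.rpow_natCast, ← Real.rpow_mul (hv0 y)]; norm_num [hβd]
    · rw [Real.zero_rpow]
      have : 0 < p - 1 := by linarith
      positivity
  rw [e1] at hH
  set Z := (∑ y ∈ B, if s ≤ ρ y then v y ^ β else 0) / (B.card : ℝ) with hZ
  rw [hsumB] at hcacc
  have hS := hSob (fun y => η y * v y) (fun y => mul_nonneg (hη0 y) (hv0 y))
    (fun y hy => by simp only [hvB y hy, mul_zero])
  set Φ := (∑ y ∈ B, (η y * v y) ^ r) / (B.card : ℝ) with hΦ
  have hΦ0 : 0 ≤ Φ := div_nonneg (Finset.sum_nonneg fun y _ =>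
    Real.rpow_nonneg (mul_nonneg (hη0 y) (hv0 y)) _) hN.le
  have hΦ2 : Φ ^ (2 / r) ≤ CS * Cμ * (n / g) ^ 2 * Z ^ ((p - 1) / p) := by
    have hcoef : 0 ≤ CS * n ^ 2 / B.card := by positivity
    have h1 := mul_le_mul_of_nonneg_left (hcacc.trans
      (mul_le_mul_of_nonneg_left hH (by positivity))) hcoef
    refine hS.trans (h1.trans (le_of_eq ?_))
    field_simp
  have hΦ3 : Φ ≤ (CS * Cμ * (n / g) ^ 2 * Z ^ ((p - 1) / p)) ^ (r / 2) := by
    have h1 := Real.rpow_le_rpow (Real.rpow_nonneg hΦ0 _) hΦ2 (show (0:ℝ) ≤ r / 2 by positivity)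
    rw [← Real.rpow_mul hΦ0] at h1
    have : 2 / r * (r / 2) = 1 := by field_simp
    rwa [this, Real.rpow_one] at h1
  have hκ0 : 0 < κ' - κ := by linarith
  refine le_trans ?_ (mul_le_mul_of_nonneg_left hΦ3 (Real.rpow_nonneg (by positivity) _))
  rw [hΦ, ← mul_div_assoc, Finset.mul_sum]
  apply div_le_div_of_nonneg_right _ hN.le
  refine Finset.sum_le_sum fun y _ => ?_
  have hnn : 0 ≤ (1 / (κ' - κ)) ^ (r - β) * (η y * v y) ^ r :=
    mul_nonneg (Real.rpow_nonneg (by positivity) _)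
      (Real.rpow_nonneg (mul_nonneg (hη0 y) (hv0 y)) _)
  split_ifs with hsy
  · rcases le_or_gt (u y - κ') 0 with h | h
    · rw [max_eq_right h, Real.zero_rpow hβ.ne']; exact hnn
    · rw [max_eq_left h.le, hη1 y hsy, one_mul]
      have hvy : v y = u y - κ := max_eq_left (by linarith)
      have hvpos : 0 < v y := by rw [hvy]; linarith
      have h1 : (u y - κ') ^ β ≤ v y ^ β := Real.rpow_le_rpow h.le (by rw [hvy]; linarith) hβ.le
      have h2 : v y ^ r = v y ^ (r - β) * v y ^ β := by
        rw [← Real.rpow_add hvpos]; ring_nf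
      rw [h2, ← mul_assoc, ← Real.mul_rpow (by positivity) hvpos.le]
      have h3 : 1 ≤ 1 / (κ' - κ) * v y := by
        rw [one_div, ← div_eq_inv_mul, le_div_iff₀ hκ0, hvy]; linarith
      have h4 : 1 ≤ (1 / (κ' - κ) * v y) ^ (r - β) := Real.one_le_rpow h3 (by linarith)
      have : 0 ≤ v y ^ β := Real.rpow_nonneg hvpos.le _
      nlinarith
  · exact hnn

end Abstract3

section Abstract4
variable {V : Type}

/-- Bound on the initial quantity, from the energy of the truncation. -/
lemma dg_init (β r CS Creg n m S T : ℝ) (hβ : 0 < β) (hr : β < r)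
    (hCS : 0 < CS) (hCreg : 0 < Creg) (hm : 0 < m)
    (Λ B : Finset V) (hBΛ : B ⊆ Λ) (hB : B.Nonempty) (c : V → V → ℝ)
    (hc : ∀ y z, c y z = c z y) (hc0 : ∀ y z, 0 ≤ c y z) (A : V → Prop) [DecidablePred A]
    (x : V) (u : V → ℝ)
    (hN1 : Creg⁻¹ * m ≤ B.card)
    (hSob : ∀ f : V → ℝ, (∀ y, 0 ≤ f y) → (∀ y, y ∉ B → f y = 0) →
      ((∑ y ∈ B, f y ^ r) / (B.card : ℝ)) ^ (2 / r) ≤ CS * n ^ 2 / B.card * En Λ c f)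
    (hu0 : ∀ y, 0 ≤ u y) (huB : ∀ y, y ∉ B → u y = 0)
    (huL : ∀ y ∈ B, ∑ z ∈ Λ, c y z * (u y - u z) = if y = x then 1 else 0)
    (hS0 : 0 < S) (hT : 0 < T)
    (hS : ∀ z, A z → u z ≤ S) (hST : n ^ 2 * S = T ^ 2 * m) :
    (∑ y ∈ B, if A y then u y ^ β else 0) / (B.card : ℝ) ≤
      (1 + (2 * CS * Creg) ^ (r / 2)) * T ^ β := by
  have hN : (0 : ℝ) < B.card := by exact_mod_cast hB.card_pos
  have hr0 : 0 < r := hβ.trans hr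
  set w : V → ℝ := fun y => min (u y) S with hw
  have hw0 : ∀ y, 0 ≤ w y := fun y => le_min (hu0 y) hS0.le
  have hwB : ∀ y, y ∉ B → w y = 0 := fun y hy => by
    simp only [hw]; rw [huB y hy]; exact min_eq_left hS0.le
  have hE : En Λ c w ≤ 2 * S := by
    refine (trunc_energy Λ c hc hc0 u w fun y z => trunc_min S (u y) (u z)).trans ?_
    rw [← Finset.sum_subset hBΛ (f := fun y => w y * ∑ z ∈ Λ, c y z * (u y - u z))
      (fun y _ hy => by rw [hwB y hy, zero_mul])]
    have : ∑ y ∈ B, w y * ∑ z ∈ Λ, c y z * (u y - u z) = ∑ y ∈ B, if y = x then w y else 0 := by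
      refine Finset.sum_congr rfl fun y hy => ?_
      rw [huL y hy]; simp
    rw [this, Finset.sum_ite_eq']
    split_ifs
    · have : w x ≤ S := min_le_right _ _
      linarith
    · linarith
  have h1 := hSob w hw0 hwB
  set Φ := (∑ y ∈ B, w y ^ r) / (B.card : ℝ) with hΦ
  have hΦ0 : 0 ≤ Φ := div_nonneg (Finset.sum_nonneg fun y _ => Real.rpow_nonneg (hw0 y) _) hN.le
  have h2 : Φ ^ (2 / r) ≤ 2 * CS * Creg * T ^ 2 := by
    refine h1.trans ((mul_le_mul_of_nonneg_left hE (by positivity)).trans ?_)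
    have : CS * n ^ 2 / B.card * (2 * S) = 2 * CS * (n ^ 2 * S) / B.card := by ring
    rw [this, hST, div_le_iff₀ hN]
    have h3 : m ≤ Creg * B.card := by
      rw [inv_mul_le_iff₀ hCreg] at hN1; exact hN1
    calc 2 * CS * (T ^ 2 * m) ≤ 2 * CS * (T ^ 2 * (Creg * B.card)) := by gcongr
      _ = _ := by ring
  have h3 : Φ ≤ (2 * CS * Creg) ^ (r / 2) * T ^ r := by
    have h1 := Real.rpow_le_rpow (Real.rpow_nonneg hΦ0 _) h2 (show (0:ℝ) ≤ r / 2 by positivity)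
    rw [← Real.rpow_mul hΦ0, Real.mul_rpow (by positivity) (by positivity),
      ← Real.rpow_natCast T 2, ← Real.rpow_mul hT.le] at h1
    have e1 : 2 / r * (r / 2) = 1 := by field_simp
    have e2 : ((2 : ℕ) : ℝ) * (r / 2) = r := by push_cast; ring
    rwa [e1, e2, Real.rpow_one] at h1
  have h4 : ∀ y, (if A y then u y ^ β else 0) ≤ T ^ β + T ^ (β - r) * w y ^ r := by
    intro y
    have hn : 0 ≤ T ^ (β - r) * w y ^ r :=
      mul_nonneg (Real.rpow_nonneg hT.le _) (Real.rpow_nonneg (hw0 y) _)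
    have hn2 : 0 ≤ T ^ β := Real.rpow_nonneg hT.le _
    split_ifs with hA
    · have hwy : w y = u y := min_eq_left (hS y hA)
      rw [hwy] at hn ⊢
      rcases le_or_gt (u y) T with h | h
      · have := Real.rpow_le_rpow (hu0 y) h hβ.le
        linarith
      · have hup : 0 < u y := hT.trans h
        have e1 : T ^ (β - r) * u y ^ r = (u y / T) ^ (r - β) * u y ^ β := by
          have : β - r = -(r - β) := by ring
          rw [this, Real.rpow_neg hT.le, Real.div_rpow hup.le hT.le]
          have : u y ^ r = u y ^ (r - β) * u y ^ β := by rw [← Real.rpow_add hup]; ring_nf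
          rw [this]
          have : T ^ (r - β) ≠ 0 := (Real.rpow_pos_of_pos hT _).ne'
          field_simp
        have e2 : 1 ≤ (u y / T) ^ (r - β) :=
          Real.one_le_rpow (by rw [le_div_iff₀ hT]; linarith) (by linarith)
        have e3 : 0 ≤ u y ^ β := Real.rpow_nonneg hup.le _
        rw [e1]; nlinarith
    · linarith
  have h5 : ∑ y ∈ B, (if A y then u y ^ β else 0) ≤ B.card * T ^ β + T ^ (β - r) * ∑ y ∈ B, w y ^ r := by
    refine (Finset.sum_le_sum fun y _ => h4 y).trans (le_of_eq ?_)
    rw [Finset.sum_add_distrib, Finset.mul_sum]; simp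
  have h6 : (∑ y ∈ B, if A y then u y ^ β else 0) / (B.card : ℝ) ≤ T ^ β + T ^ (β - r) * Φ := by
    rw [div_le_iff₀ hN]
    refine h5.trans (le_of_eq ?_)
    rw [hΦ]; field_simp
  refine h6.trans ?_
  have h7 : T ^ (β - r) * Φ ≤ T ^ (β - r) * ((2 * CS * Creg) ^ (r / 2) * T ^ r) :=
    mul_le_mul_of_nonneg_left h3 (Real.rpow_nonneg hT.le _)
  have h8 : T ^ β = T ^ (β - r) * T ^ r := by rw [← Real.rpow_add hT]; ring_nf
  calc _ ≤ T ^ β + T ^ (β - r) * ((2 * CS * Creg) ^ (r / 2) * T ^ r) := by linarith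
    _ = T ^ β + (2 * CS * Creg) ^ (r / 2) * (T ^ (β - r) * T ^ r) := by ring
    _ = _ := by rw [← h8]; ring

set_option maxHeartbeats 2000000 in
theorem one_scale (d : ℕ) (p r CS Cμ Creg : ℝ) (hp : 1 < p) (hr : 2 * (p / (p - 1)) < r)
    (hCS : 0 < CS) (hCμ : 0 < Cμ) (hCreg : 0 < Creg) :
    ∃ C : ℝ, 0 < C ∧ ∀ (Λ B : Finset V) (_ : B ⊆ Λ) (_ : B.Nonempty) (c : V → V → ℝ)
      (_ : ∀ y z, c y z = c z y) (_ : ∀ y z, 0 ≤ c y z) (ρ : V → ℕ) (x : V) (u : V → ℝ)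
      (_ : ∀ y z, 0 < c y z → ρ y ≤ ρ z + 1) (_ : ρ x = 0)
      (_ : ∑ y ∈ B, (∑ z ∈ Λ, c y z) ^ p ≤ Cμ ^ p * B.card)
      (k : ℕ) (_ : 3 ≤ k)
      (_ : Creg⁻¹ * ((2:ℝ) ^ k) ^ d ≤ B.card) (_ : (B.card : ℝ) ≤ Creg * ((2:ℝ) ^ k) ^ d)
      (_ : ∀ f : V → ℝ, (∀ y, 0 ≤ f y) → (∀ y, y ∉ B → f y = 0) →
        ((∑ y ∈ B, f y ^ r) / (B.card : ℝ)) ^ (2 / r) ≤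
          CS * ((2:ℝ) ^ k) ^ 2 / B.card * En Λ c f)
      (_ : ∀ y, 0 ≤ u y) (_ : ∀ y, y ∉ B → u y = 0)
      (_ : ∀ y ∈ B, ∑ z ∈ Λ, c y z * (u y - u z) = if y = x then 1 else 0)
      (S T : ℝ) (_ : 0 < S) (_ : 0 < T)
      (_ : ∀ z, 2 ^ (k - 2) ≤ ρ z → u z ≤ S)
      (_ : ((2:ℝ) ^ k) ^ 2 * S = T ^ 2 * ((2:ℝ) ^ k) ^ d),
      ∀ z, 2 ^ (k - 1) ≤ ρ z → u z ≤ C * T := by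
  set β : ℝ := 2 * (p / (p - 1)) with hβd
  have hp1 : 0 < p - 1 := by linarith
  have hβ : 0 < β := by positivity
  have hr0 : 0 < r := hβ.trans hr
  set ε : ℝ := r / β - 1 with hεd
  have hε : 0 < ε := by
    have : 1 < r / β := by rw [lt_div_iff₀ hβ]; linarith
    linarith
  set E0 : ℝ := 2 ^ (r - β) * (64 * CS * Cμ) ^ (r / 2) with hE0d
  have hE0 : 0 < E0 := by positivity
  set Q : ℝ := 2 ^ (r - β) * 4 ^ (r / 2) with hQd
  have hQ : 0 < Q := by positivity
  set b : ℝ := max (2 ^ d) (Q ^ (1 / ε)) with hbd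
  have hb : 0 < b := lt_of_lt_of_le (by positivity) (le_max_left _ _)
  have hb2 : (2:ℝ) ^ d ≤ b := le_max_left _ _
  have hQb : Q ≤ b ^ ε := by
    have h1 := Real.rpow_le_rpow (by positivity) (le_max_right ((2:ℝ) ^ d) (Q ^ (1 / ε))) hε.le
    rw [← Real.rpow_mul hQ.le, one_div_mul_cancel hε.ne', Real.rpow_one] at h1
    exact h1
  set c₀ : ℝ := (1 / (E0 * b)) ^ (1 / ε) with hc₀d
  have hc₀ : 0 < c₀ := by positivity
  have hcE : E0 * c₀ ^ ε * b ≤ 1 := by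
    rw [hc₀d, ← Real.rpow_mul (by positivity), one_div_mul_cancel hε.ne', Real.rpow_one]
    apply le_of_eq; field_simp
  set D : ℝ := 1 + (2 * CS * Creg) ^ (r / 2) with hDd
  have hD : 0 < D := by positivity
  set C0 : ℝ := (D / c₀) ^ (1 / β) with hC0d
  have hC0 : 0 < C0 := by positivity
  have hC0β : C0 ^ β = D / c₀ := by
    rw [hC0d, ← Real.rpow_mul (by positivity), one_div_mul_cancel hβ.ne', Real.rpow_one]
  refine ⟨C0 * (1 + (Creg * c₀ * b ^ 2) ^ (1 / β)), by positivity, ?_⟩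
  intro Λ B hBΛ hB c hc hc0 ρ x u hLip hρx hμ k hk hN1 hN2 hSob hu0 huB huL S T hS0 hT hS hST z hz
  have hN : (0 : ℝ) < B.card := by exact_mod_cast hB.card_pos
  set K : ℝ := C0 * T with hKd
  have hK : 0 < K := by positivity
  have hKβ : 0 < K ^ β := by positivity
  set s : ℕ → ℕ := fun j => 2 ^ (k - 1) - 2 ^ (k - 2 - j) with hsd
  set κ : ℕ → ℝ := fun j => K * (1 - (1 / 2) ^ j) with hκd
  set Z : ℕ → ℝ := fun j =>
    (∑ y ∈ B, if s j ≤ ρ y then max (u y - κ j) 0 ^ β else 0) / (B.card : ℝ) with hZd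
  have hZ0 : ∀ j, 0 ≤ Z j := fun j => div_nonneg (Finset.sum_nonneg fun y _ => by
    split_ifs
    · exact Real.rpow_nonneg (le_max_right _ _) _
    · exact le_rfl) hN.le
  have hZinit : Z 0 ≤ D * T ^ β := by
    have h1 := dg_init β r CS Creg ((2:ℝ) ^ k) (((2:ℝ) ^ k) ^ d) S T hβ hr hCS hCreg (by positivity)
      Λ B hBΛ hB c hc hc0 (fun y => 2 ^ (k - 2) ≤ ρ y) x u hN1 hSob hu0 huB huL hS0 hT hS hST
    refine le_trans (le_of_eq ?_) h1
    have e1 : s 0 = 2 ^ (k - 2) := by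
      simp only [hsd, Nat.sub_zero]
      have : k - 1 = (k - 2) + 1 := by omega
      rw [this, pow_succ]; omega
    have e2 : κ 0 = 0 := by simp [hκd]
    simp only [hZd, e1, e2, sub_zero]
    congr 1
    refine Finset.sum_congr rfl fun y _ => ?_
    rw [max_eq_left (hu0 y)]
  have hstep : ∀ j, j < k - 2 → Z (j + 1) / K ^ β ≤ E0 * Q ^ j * (Z j / K ^ β) ^ (1 + ε) := by
    intro j hj
    have hpow : (2:ℕ) ^ (k - 2 - j) = 2 ^ (k - 3 - j) + 2 ^ (k - 3 - j) := by
      have : k - 2 - j = (k - 3 - j) + 1 := by omega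
      rw [this, pow_succ]; omega
    have hle : (2:ℕ) ^ (k - 2 - j) ≤ 2 ^ (k - 2) := Nat.pow_le_pow_right (by norm_num) (by omega)
    have hpos : 0 < (2:ℕ) ^ (k - 3 - j) := by positivity
    have h12 : (2:ℕ) ^ (k - 1) = 2 ^ (k - 2) + 2 ^ (k - 2) := by
      have : k - 1 = (k - 2) + 1 := by omega
      rw [this, pow_succ]; omega
    have hsj : s (j + 1) = s j + 2 ^ (k - 3 - j) := by
      simp only [hsd]
      have : k - 2 - (j + 1) = k - 3 - j := by omega
      rw [this]; omega
    have hsj1 : 1 ≤ s j := by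
      have : 0 < (2:ℕ) ^ (k - 2) := by positivity
      simp only [hsd]; omega
    have hκj : κ (j + 1) - κ j = K * (1 / 2) ^ (j + 1) := by
      simp only [hκd]; rw [pow_succ]; ring
    have hκ0 : 0 ≤ κ j := by
      simp only [hκd]
      have : (1 / 2 : ℝ) ^ j ≤ 1 := pow_le_one₀ (by norm_num) (by norm_num)
      exact mul_nonneg hK.le (by linarith)
    have hκlt : κ j < κ (j + 1) := by
      have : 0 < K * (1 / 2) ^ (j + 1) := by positivity
      linarith
    have h1 := dg_step p r CS Cμ ((2:ℝ) ^ k) hp hr hCS.le hCμ.le Λ B hBΛ hB c hc hc0 ρ x u hLip hρx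
      hμ hSob huB huL (s j) (s (j + 1)) hsj1 (by omega) (κ j) (κ (j + 1)) hκ0 hκlt
    rw [← hβd, hκj] at h1
    have hgap : (2:ℝ) ^ k / ((s (j + 1) : ℝ) - (s j : ℝ)) = 8 * 2 ^ j := by
      rw [hsj]; push_cast
      have : (2:ℝ) ^ k = 2 ^ (k - 3 - j) * (8 * 2 ^ j) := by
        have h8 : (8:ℝ) = 2 ^ 3 := by norm_num
        rw [h8, ← pow_add, ← pow_add]; congr 1; omega
      rw [this]; field_simp; ring
    rw [hgap] at h1
    change Z (j + 1) ≤ (1 / (K * (1 / 2) ^ (j + 1))) ^ (r - β) *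
      (CS * Cμ * (8 * 2 ^ j) ^ 2 * Z j ^ ((p - 1) / p)) ^ (r / 2) at h1
    have e1 : (1 / (K * (1 / 2) ^ (j + 1))) ^ (r - β) =
        2 ^ (r - β) * (2 ^ (r - β)) ^ j / K ^ (r - β) := by
      have : 1 / (K * (1 / 2) ^ (j + 1)) = (2 * 2 ^ j) / K := by
        rw [one_div_pow, pow_succ]; field_simp
      rw [this, Real.div_rpow (by positivity) hK.le, Real.mul_rpow (by norm_num) (by positivity)]
      congr 2
      rw [← Real.rpow_natCast, ← Real.rpow_natCast, ← Real.rpow_mul (by norm_num),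
        ← Real.rpow_mul (by norm_num), mul_comm]
    have e2 : (CS * Cμ * (8 * 2 ^ j) ^ 2 * Z j ^ ((p - 1) / p)) ^ (r / 2) =
        (64 * CS * Cμ) ^ (r / 2) * (4 ^ (r / 2)) ^ j * Z j ^ (1 + ε) := by
      have : CS * Cμ * (8 * 2 ^ j) ^ 2 * Z j ^ ((p - 1) / p) =
          (64 * CS * Cμ) * 4 ^ j * Z j ^ ((p - 1) / p) := by
        have h4 : ((2:ℝ)^j)^2 = 4^j := by rw [← pow_mul, mul_comm, pow_mul]; norm_num
        rw [mul_pow, h4]; ring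
      rw [this, Real.mul_rpow (by positivity) (Real.rpow_nonneg (hZ0 j) _),
        Real.mul_rpow (by positivity) (by positivity), ← Real.rpow_mul (hZ0 j)]
      congr 1
      · congr 1
        rw [← Real.rpow_natCast, ← Real.rpow_natCast, ← Real.rpow_mul (by norm_num),
        ← Real.rpow_mul (by norm_num), mul_comm]
      · congr 1
        rw [hεd, hβd]; field_simp; ring
    rw [e1, e2] at h1
    rw [div_le_iff₀ hKβ]
    refine h1.trans (le_of_eq ?_)
    have e3 : (K ^ β) ^ (1 + ε) = K ^ (r - β) * K ^ β := by
      rw [← Real.rpow_mul hK.le, ← Real.rpow_add hK]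
      congr 1
      rw [hεd]; field_simp; ring
    rw [Real.div_rpow (hZ0 j) hKβ.le, e3, hE0d, hQd, mul_pow]
    have : K ^ (r - β) ≠ 0 := (Real.rpow_pos_of_pos hK _).ne'
    field_simp
  have hdec := fast_decay E0 Q ε b c₀ (k - 2) (fun j => Z j / K ^ β) hE0 hQ.le hε hb hc₀ hQb hcE
    (fun j => div_nonneg (hZ0 j) hKβ.le)
    (by
      show Z 0 / K ^ β ≤ c₀
      rw [div_le_iff₀ hKβ]
      refine hZinit.trans (le_of_eq ?_)
      rw [hKd, Real.mul_rpow hC0.le hT.le, hC0β]; field_simp)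
    hstep (k - 2) le_rfl
  have hdec' : Z (k - 2) ≤ c₀ / b ^ (k - 2) * K ^ β := by
    rwa [div_le_iff₀ hKβ] at hdec
  have hconst : 0 ≤ (Creg * c₀ * b ^ 2) ^ (1 / β) := by positivity
  rcases le_or_gt (u z) K with h | h
  · refine h.trans ?_
    rw [hKd]
    nlinarith [mul_nonneg (mul_nonneg hC0.le hT.le) hconst]
  have hzB : z ∈ B := by
    by_contra hzB
    rw [huB z hzB] at h; linarith
  have hzs : s (k - 2) ≤ ρ z := by
    exact le_trans (Nat.sub_le _ _) hz
  have h1 : (u z - K) ^ β ≤ B.card * Z (k - 2) := by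
    have e : B.card * Z (k - 2) = ∑ y ∈ B, if s (k - 2) ≤ ρ y then max (u y - κ (k - 2)) 0 ^ β else 0 := by
      simp only [hZd]; field_simp
    rw [e]
    have h2 := Finset.single_le_sum (f := fun y => if s (k - 2) ≤ ρ y then
      max (u y - κ (k - 2)) 0 ^ β else 0) (fun y _ => by
        show 0 ≤ if s (k - 2) ≤ ρ y then max (u y - κ (k - 2)) 0 ^ β else 0
        split_ifs
        · exact Real.rpow_nonneg (le_max_right _ _) _
        · exact le_rfl) hzB
    refine le_trans ?_ h2
    simp only [hzs, if_true]
    refine Real.rpow_le_rpow (by linarith) (le_trans ?_ (le_max_left _ _)) hβ.le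
    have : κ (k - 2) ≤ K := by
      simp only [hκd]
      have : 0 ≤ K * (1 / 2) ^ (k - 2) := by positivity
      linarith
    linarith
  have h2 : (u z - K) ^ β ≤ (Creg * c₀ * b ^ 2) * K ^ β := by
    refine h1.trans ?_
    calc (B.card : ℝ) * Z (k - 2) ≤ (Creg * ((2:ℝ) ^ k) ^ d) * (c₀ / b ^ (k - 2) * K ^ β) :=
          mul_le_mul hN2 hdec' (hZ0 _) (by positivity)
      _ ≤ (Creg * b ^ k) * (c₀ / b ^ (k - 2) * K ^ β) := by
          have : ((2:ℝ) ^ k) ^ d ≤ b ^ k := by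
            rw [← pow_mul, mul_comm, pow_mul]
            exact pow_le_pow_left₀ (by positivity) hb2 k
          gcongr
      _ = (Creg * c₀ * b ^ 2) * K ^ β := by
          have : b ^ k = b ^ (k - 2) * b ^ 2 := by rw [← pow_add]; congr 1; omega
          rw [this]; field_simp
  have h3 : u z - K ≤ (Creg * c₀ * b ^ 2) ^ (1 / β) * K := by
    have h4 := Real.rpow_le_rpow (Real.rpow_nonneg (by linarith) _) h2
      (show (0:ℝ) ≤ 1 / β by positivity)
    rw [← Real.rpow_mul (by linarith), mul_one_div_cancel hβ.ne', Real.rpow_one,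
      Real.mul_rpow (by positivity) hKβ.le, ← Real.rpow_mul hK.le, mul_one_div_cancel hβ.ne',
      Real.rpow_one] at h4
    exact h4
  rw [hKd] at h3
  rw [hKd] at h
  nlinarith

end Abstract4

section Abstract5
variable {V : Type}

/-- Non-degeneracy of the Dirichlet form on functions supported in `B`. -/
def NonDeg (Λ B : Finset V) (c : V → V → ℝ) : Prop :=
  ∀ f : V → ℝ, (∀ y, 0 ≤ f y) → (∀ y, y ∉ B → f y = 0) → En Λ c f ≤ 0 → ∀ y, f y = 0

lemma nonDeg_of_sob (Λ B : Finset V) (hB : B.Nonempty) (c : V → V → ℝ) (r K : ℝ) (hr : 0 < r)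
    (hK : 0 ≤ K)
    (hS : ∀ f : V → ℝ, (∀ y, 0 ≤ f y) → (∀ y, y ∉ B → f y = 0) →
        ((∑ y ∈ B, f y ^ r) / (B.card : ℝ)) ^ (2 / r) ≤ K * En Λ c f) : NonDeg Λ B c := by
  intro f hf hfB hE y
  by_cases hy : y ∈ B
  swap
  · exact hfB y hy
  have hN : (0 : ℝ) < B.card := by exact_mod_cast hB.card_pos
  have hs0 : 0 ≤ ∑ y ∈ B, f y ^ r := Finset.sum_nonneg fun z _ => Real.rpow_nonneg (hf z) _
  have h := hS f hf hfB
  have h0 : ((∑ y ∈ B, f y ^ r) / (B.card : ℝ)) ^ (2 / r) ≤ 0 :=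
    h.trans (mul_nonpos_of_nonneg_of_nonpos hK hE)
  have h1 : (∑ y ∈ B, f y ^ r) / (B.card : ℝ) = 0 := by
    by_contra hne
    have : 0 < (∑ y ∈ B, f y ^ r) / (B.card : ℝ) :=
      lt_of_le_of_ne (div_nonneg hs0 hN.le) (Ne.symm hne)
    have := Real.rpow_pos_of_pos this (2 / r)
    linarith
  have h2 : ∑ y ∈ B, f y ^ r = 0 := by
    rcases div_eq_zero_iff.1 h1 with h | h
    · exact h
    · exact absurd h hN.ne'
  have h3 := (Finset.sum_eq_zero_iff_of_nonneg fun z _ => Real.rpow_nonneg (hf z) r).1 h2 y hy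
  exact ((Real.rpow_eq_zero (hf y) hr.ne').1 h3)

lemma max_principle (Λ B : Finset V) (c : V → V → ℝ) (hBΛ : B ⊆ Λ) (hc : ∀ y z, c y z = c z y)
    (hc0 : ∀ y z, 0 ≤ c y z) (hnd : NonDeg Λ B c) (w : V → ℝ) (m : ℝ)
    (hL : ∀ y ∈ B, ∑ z ∈ Λ, c y z * (w y - w z) ≤ 0) (hoff : ∀ y, y ∉ B → w y ≤ m) (y : V) :
    w y ≤ m := by
  have hE := trunc_energy Λ c hc hc0 w (fun y => max (w y - m) 0)
    (fun y z => trunc_max m (w y) (w z))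
  have hoff' : ∀ y, y ∉ B → max (w y - m) 0 = 0 := fun y hy =>
    max_eq_right (by linarith [hoff y hy])
  have h1 : ∑ y ∈ Λ, max (w y - m) 0 * ∑ z ∈ Λ, c y z * (w y - w z) ≤ 0 := by
    refine Finset.sum_nonpos fun y _ => ?_
    by_cases hy : y ∈ B
    · exact mul_nonpos_of_nonneg_of_nonpos (le_max_right _ _) (hL y hy)
    · rw [hoff' y hy]; simp
  have h2 := hnd (fun y => max (w y - m) 0) (fun y => le_max_right _ _) hoff' (by linarith) y
  have h3 := le_max_left (w y - m) 0
  linarith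

lemma green_exists (Λ B : Finset V) (c : V → V → ℝ) (hBΛ : B ⊆ Λ) (hc : ∀ y z, c y z = c z y)
    (hc0 : ∀ y z, 0 ≤ c y z) (hnd : NonDeg Λ B c) (y₀ : V) :
    ∃ u : V → ℝ, (∀ y, 0 ≤ u y) ∧ (∀ y, y ∉ B → u y = 0) ∧
      ∀ y ∈ B, ∑ z ∈ Λ, c y z * (u y - u z) = if y = y₀ then 1 else 0 := by
  let ext : (B → ℝ) → V → ℝ := fun f y => if h : y ∈ B then f ⟨y, h⟩ else 0
  let T : (B → ℝ) →ₗ[ℝ] (B → ℝ) :=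
    { toFun := fun f y => ∑ z ∈ Λ, c y z * (ext f y - ext f z)
      map_add' := by
        intro f g
        funext y
        simp only [Pi.add_apply]
        rw [← Finset.sum_add_distrib]
        refine Finset.sum_congr rfl fun z _ => ?_
        have : ∀ v, ext (f + g) v = ext f v + ext g v := by
          intro v; simp only [ext]; split_ifs <;> simp
        rw [this, this]; ring
      map_smul' := by
        intro t f
        funext y
        simp only [Pi.smul_apply, smul_eq_mul, RingHom.id_apply]
        rw [Finset.mul_sum]
        refine Finset.sum_congr rfl fun z _ => ?_
        have : ∀ v, ext (t • f) v = t * ext f v := by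
          intro v; simp only [ext]; split_ifs <;> simp
        rw [this, this]; ring }
  have hext : ∀ f y, y ∉ B → ext f y = 0 := fun f y hy => by simp [ext, hy]
  have hinj : Function.Injective T := by
    rw [← LinearMap.ker_eq_bot, LinearMap.ker_eq_bot']
    intro f hf
    have hT : ∀ y ∈ B, ∑ z ∈ Λ, c y z * (ext f y - ext f z) = 0 := fun y hy =>
      congrFun hf ⟨y, hy⟩
    have h1 := max_principle Λ B c hBΛ hc hc0 hnd (ext f) 0 (fun y hy => (hT y hy).le)
      (fun y hy => (hext f y hy).le)
    have h2 := max_principle Λ B c hBΛ hc hc0 hnd (fun y => - ext f y) 0 (fun y hy => by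
        have : ∑ z ∈ Λ, c y z * (- ext f y - - ext f z) =
            - ∑ z ∈ Λ, c y z * (ext f y - ext f z) := by
          rw [← Finset.sum_neg_distrib]
          exact Finset.sum_congr rfl fun z _ => by ring
        rw [this, hT y hy]; simp)
      (fun y hy => by simp [hext f y hy])
    funext y
    have e : f y = ext f y := by simp [ext]
    rw [e]
    have := h2 y
    exact le_antisymm (h1 y) (by show (0:ℝ) ≤ ext f y; linarith)
  have hsurj : Function.Surjective T := LinearMap.injective_iff_surjective.1 hinj
  obtain ⟨f, hf⟩ := hsurj (fun y => if (y : V) = y₀ then 1 else 0)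
  have hfe : ∀ y ∈ B, ∑ z ∈ Λ, c y z * (ext f y - ext f z) = if y = y₀ then 1 else 0 :=
    fun y hy => congrFun hf ⟨y, hy⟩
  refine ⟨ext f, ?_, hext f, hfe⟩
  intro y
  have h2 := max_principle Λ B c hBΛ hc hc0 hnd (fun y => - ext f y) 0 (fun y hy => by
        have : ∑ z ∈ Λ, c y z * (- ext f y - - ext f z) =
            - ∑ z ∈ Λ, c y z * (ext f y - ext f z) := by
          rw [← Finset.sum_neg_distrib]
          exact Finset.sum_congr rfl fun z _ => by ring
        rw [this, hfe y hy]; split_ifs <;> simp)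
      (fun y hy => by simp [hext f y hy]) y
  linarith

lemma green_symm (Λ B : Finset V) (c : V → V → ℝ) (hBΛ : B ⊆ Λ) (hc : ∀ y z, c y z = c z y)
    (u v : V → ℝ) (x y : V) (huB : ∀ y, y ∉ B → u y = 0) (hvB : ∀ y, y ∉ B → v y = 0)
    (hu : ∀ z ∈ B, ∑ w ∈ Λ, c z w * (u z - u w) = if z = x then 1 else 0)
    (hv : ∀ z ∈ B, ∑ w ∈ Λ, c z w * (v z - v w) = if z = y then 1 else 0) : v x = u y := by
  have key : ∀ (f h : V → ℝ) (x : V), (∀ y, y ∉ B → h y = 0) →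
      (∀ z ∈ B, ∑ w ∈ Λ, c z w * (f z - f w) = if z = x then 1 else 0) →
      ∑ z ∈ Λ, h z * ∑ w ∈ Λ, c z w * (f z - f w) = h x := by
    intro f h x hh hf
    rw [← Finset.sum_subset hBΛ (fun z _ hz => by rw [hh z hz, zero_mul])]
    rw [Finset.sum_congr rfl (fun z hz => by rw [hf z hz])]
    by_cases hx : x ∈ B
    · simp [hx]
    · simp [hx, hh x hx]
  have h1 := sbp Λ c hc u v
  have h2 := sbp Λ c hc v u
  rw [key u v x hvB hu] at h1
  rw [key v u y huB hv] at h2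
  have : ∑ y ∈ Λ, ∑ z ∈ Λ, c y z * (u y - u z) * (v y - v z) =
      ∑ y ∈ Λ, ∑ z ∈ Λ, c y z * (v y - v z) * (u y - u z) :=
    Finset.sum_congr rfl fun y _ => Finset.sum_congr rfl fun z _ => by ring
  linarith

end Abstract5

section Abstract6
variable {V : Type}

/-- The decay of the killed Green functions across dyadic scales, and of their limit. -/
theorem abstract_green (e : ℕ) (he : 1 ≤ e) (p r CS Cμ Creg : ℝ) (hp : 1 < p)
    (hr : 2 * (p / (p - 1)) < r)
    (hCS : 0 < CS) (hCμ : 0 < Cμ) (hCreg : 0 < Creg)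
    (c : V → V → ℝ) (hc : ∀ y z, c y z = c z y) (hc0 : ∀ y z, 0 ≤ c y z)
    (ρ : V → ℕ) (hρ : ∀ y z, 0 < c y z → ρ y ≤ ρ z + 1) (x : V) (hρx : ρ x = 0)
    (K : Set V) (nb : V → Finset V) (B Λ : ℕ → Finset V) (k₀ : ℕ) (hk₀ : 3 ≤ k₀)
    (hBK : ∀ k, k₀ ≤ k → ∀ y, y ∈ B k ↔ y ∈ K ∧ ρ y ≤ 2 ^ k)
    (hBΛ : ∀ k, k₀ ≤ k → B k ⊆ Λ k) (hnb : ∀ k, k₀ ≤ k → ∀ y ∈ B k, nb y ⊆ Λ k)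
    (hnbc : ∀ y z, z ∉ nb y → c y z = 0)
    (hxK : x ∈ K)
    (hμ : ∀ k, k₀ ≤ k → ∑ y ∈ B k, (∑ z ∈ Λ k, c y z) ^ p ≤ Cμ ^ p * (B k).card)
    (hN1 : ∀ k, k₀ ≤ k → Creg⁻¹ * ((2:ℝ) ^ k) ^ (e + 2) ≤ (B k).card)
    (hN2 : ∀ k, k₀ ≤ k → ((B k).card : ℝ) ≤ Creg * ((2:ℝ) ^ k) ^ (e + 2))
    (hSob : ∀ k, k₀ ≤ k → ∀ f : V → ℝ, (∀ y, 0 ≤ f y) → (∀ y, y ∉ B k → f y = 0) →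
        ((∑ y ∈ B k, f y ^ r) / ((B k).card : ℝ)) ^ (2 / r) ≤
          CS * ((2:ℝ) ^ k) ^ 2 / (B k).card * En (Λ k) c f)
    (g : V → V → ℝ) (hg0 : ∀ y z, 0 ≤ g y z)
    (hg : ∀ y ∈ K, ∀ z ∈ K, ∑ w ∈ nb z, c z w * (g z y - g w y) = if z = y then 1 else 0)
    (hmin : ∀ g' : V → V → ℝ, (∀ y z, 0 ≤ g' y z) →
      (∀ y ∈ K, ∀ z ∈ K, ∑ w ∈ nb z, c z w * (g' z y - g' w y) = if z = y then 1 else 0) →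
      ∀ y ∈ K, ∀ z ∈ K, g y z ≤ g' y z) :
    ∃ D : ℝ, 0 < D ∧ ∀ y ∈ K, 2 ^ k₀ ≤ ρ y → g x y ≤ D / (ρ y : ℝ) ^ e := by
  have hr0 : 0 < r := by
    have : 0 < p / (p - 1) := div_pos (by linarith) (by linarith)
    linarith
  have hBne : ∀ k, k₀ ≤ k → (B k).Nonempty := fun k hk =>
    ⟨x, (hBK k hk x).2 ⟨hxK, by rw [hρx]; positivity⟩⟩
  have hnd : ∀ k, k₀ ≤ k → NonDeg (Λ k) (B k) c := fun k hk =>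
    nonDeg_of_sob (Λ k) (B k) (hBne k hk) c r (CS * ((2:ℝ) ^ k) ^ 2 / (B k).card) hr0
      (by positivity) (hSob k hk)
  have hsumΛ : ∀ k, k₀ ≤ k → ∀ y ∈ B k, ∀ f : V → ℝ,
      ∑ z ∈ Λ k, c y z * f z = ∑ z ∈ nb y, c y z * f z := fun k hk y hy f =>
    (Finset.sum_subset (hnb k hk y hy) fun z _ hz => by rw [hnbc y z hz, zero_mul]).symm
  have hex : ∀ k y₀, ∃ u : V → ℝ, k₀ ≤ k → (∀ y, 0 ≤ u y) ∧ (∀ y, y ∉ B k → u y = 0) ∧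
      ∀ y ∈ B k, ∑ z ∈ Λ k, c y z * (u y - u z) = if y = y₀ then 1 else 0 := by
    intro k y₀
    by_cases hk : k₀ ≤ k
    · obtain ⟨u, hu⟩ := green_exists (Λ k) (B k) c (hBΛ k hk) hc hc0 (hnd k hk) y₀
      exact ⟨u, fun _ => hu⟩
    · exact ⟨0, fun h => absurd h hk⟩
  choose G hG using hex
  have hG0 := fun k y₀ hk => (hG k y₀ hk).1
  have hGB := fun k y₀ hk => (hG k y₀ hk).2.1
  have hGΛ := fun k y₀ hk => (hG k y₀ hk).2.2
  have hGL : ∀ k y₀, k₀ ≤ k → ∀ y ∈ B k,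
      ∑ z ∈ nb y, c y z * (G k y₀ y - G k y₀ z) = if y = y₀ then 1 else 0 := by
    intro k y₀ hk y hy
    rw [← hsumΛ k hk y hy]
    exact hGΛ k y₀ hk y hy
  have hBmono : ∀ k, k₀ ≤ k → B k ⊆ B (k + 1) := by
    intro k hk y hy
    rw [hBK k hk] at hy
    rw [hBK (k + 1) (by omega)]
    exact ⟨hy.1, hy.2.trans (Nat.pow_le_pow_right (by norm_num) (by omega))⟩
  -- comparison principle
  have hcomp : ∀ k, k₀ ≤ k → ∀ f h : V → ℝ, ∀ m : ℝ,
      (∀ y ∈ B k, ∑ z ∈ nb y, c y z * (f y - f z) ≤ ∑ z ∈ nb y, c y z * (h y - h z)) →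
      (∀ y, y ∉ B k → f y ≤ h y + m) → ∀ y, f y ≤ h y + m := by
    intro k hk f h m hL hoff y
    have := max_principle (Λ k) (B k) c (hBΛ k hk) hc hc0 (hnd k hk) (fun y => f y - h y) m
      (fun y hy => by
        rw [hsumΛ k hk y hy (fun z => f y - h y - (f z - h z))]
        have e1 : ∑ z ∈ nb y, c y z * (f y - h y - (f z - h z)) =
          ∑ z ∈ nb y, c y z * (f y - f z) - ∑ z ∈ nb y, c y z * (h y - h z) := by
          rw [← Finset.sum_sub_distrib]
          exact Finset.sum_congr rfl fun z _ => by ring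
        rw [e1]; linarith [hL y hy])
      (fun y hy => by linarith [hoff y hy]) y
    linarith
  have hGmono : ∀ k, k₀ ≤ k → ∀ y z, G k y z ≤ G (k + 1) y z := by
    intro k hk y z
    have := hcomp k hk (G k y) (G (k + 1) y) 0 (fun v hv => by
      rw [hGL k y hk v hv, hGL (k + 1) y (by omega) v (hBmono k hk hv)])
      (fun v hv => by rw [hGB k y hk v hv]; linarith [hG0 (k + 1) y (by omega) v]) z
    linarith
  have hGg : ∀ k, k₀ ≤ k → ∀ y ∈ K, ∀ z, G k y z ≤ g z y := by
    intro k hk y hy z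
    have := hcomp k hk (G k y) (fun v => g v y) 0 (fun v hv => by
      rw [hGL k y hk v hv, hg y hy v ((hBK k hk v).1 hv).1])
      (fun v hv => by rw [hGB k y hk v hv]; linarith [hg0 v y]) z
    linarith
  have hGmono' : ∀ y z, Monotone fun j => G (k₀ + j) y z := fun y z =>
    monotone_nat_of_le_succ fun j => hGmono (k₀ + j) (by omega) y z
  -- `g` is the limit of the killed Green functions
  have hglim : ∀ y ∈ K, g x y ≤ ⨆ j, G (k₀ + j) y x := by
    intro y hy
    refine hmin (fun z y => ⨆ j, G (k₀ + j) y z) (fun z y => Real.iSup_nonneg fun j =>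
      hG0 (k₀ + j) y (by omega) z) ?_ x hxK y hy
    intro y hy z hz
    have ht : ∀ v, Tendsto (fun j => G (k₀ + j) y v) atTop (𝓝 (⨆ j, G (k₀ + j) y v)) := fun v =>
      tendsto_atTop_ciSup (hGmono' y v) ⟨g v y, by
        rintro _ ⟨j, rfl⟩
        exact hGg (k₀ + j) (by omega) y hy v⟩
    have ht2 : Tendsto (fun j => ∑ w ∈ nb z, c z w * (G (k₀ + j) y z - G (k₀ + j) y w)) atTop
        (𝓝 (∑ w ∈ nb z, c z w * ((⨆ j, G (k₀ + j) y z) - ⨆ j, G (k₀ + j) y w))) :=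
      tendsto_finsetSum _ fun w _ => ((ht z).sub (ht w)).const_mul _
    refine tendsto_nhds_unique ht2 (tendsto_const_nhds.congr' ?_)
    filter_upwards [eventually_ge_atTop (ρ z)] with j hj
    refine (hGL (k₀ + j) y (by omega) z ((hBK (k₀ + j) (by omega) z).2 ⟨hz, ?_⟩)).symm
    exact (hj.trans (Nat.le_add_left j k₀)).trans (Nat.lt_two_pow_self).le
  have hGsymm : ∀ k, k₀ ≤ k → ∀ y, G k y x = G k x y := fun k hk y =>
    green_symm (Λ k) (B k) c (hBΛ k hk) hc (G k x) (G k y) x y (hGB k x hk) (hGB k y hk)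
      (hGΛ k x hk) (hGΛ k y hk)
  obtain ⟨C, hC, hone⟩ := one_scale (V := V) (e + 2) p r CS Cμ Creg hp hr hCS hCμ hCreg
  -- comparison of consecutive scales
  have hstepcmp : ∀ k, k₀ ≤ k → ∀ m : ℝ, 0 ≤ m →
      (∀ z, 2 ^ k ≤ ρ z → G (k + 1) x z ≤ m) → ∀ z, G (k + 1) x z ≤ G k x z + m := by
    intro k hk m hm hz
    refine hcomp k hk _ _ m (fun v hv => by
      rw [hGL k x hk v hv, hGL (k + 1) x (by omega) v (hBmono k hk hv)]) ?_
    intro v hv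
    rw [hGB k x hk v hv, zero_add]
    by_cases hv' : v ∈ B (k + 1)
    · refine hz v ?_
      by_contra hlt
      exact hv ((hBK k hk v).2 ⟨((hBK (k + 1) (by omega) v).1 hv').1, by omega⟩)
    · rw [hGB (k + 1) x (by omega) v hv']; exact hm
  obtain ⟨D₀, hD₀⟩ : ∃ D₀ : ℝ, ∀ z, G k₀ x z ≤ D₀ := by
    refine ⟨∑ z ∈ B k₀, G k₀ x z, fun z => ?_⟩
    by_cases hz : z ∈ B k₀
    · exact Finset.single_le_sum (fun v _ => hG0 k₀ x le_rfl v) hz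
    · rw [hGB k₀ x le_rfl z hz]
      exact Finset.sum_nonneg fun v _ => hG0 k₀ x le_rfl v
  set D : ℝ := max 1 (max (D₀ * (2 ^ k₀) ^ e) (C ^ 2 * (1 + 2 ^ e))) with hD
  have hD1 : 1 ≤ D := le_max_left _ _
  have hD2 : D₀ * (2 ^ k₀) ^ e ≤ D := (le_max_left _ _).trans (le_max_right _ _)
  have hD3 : C ^ 2 * (1 + 2 ^ e) ≤ D := (le_max_right _ _).trans (le_max_right _ _)
  have hdecay : ∀ k, k₀ ≤ k → ∀ z, 2 ^ (k - 1) ≤ ρ z → G k x z ≤ D / ((2:ℝ) ^ k) ^ e := by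
    intro k hk
    induction k, hk using Nat.le_induction with
    | base =>
      intro z _
      rw [le_div_iff₀ (by positivity)]
      exact le_trans (mul_le_mul_of_nonneg_right (hD₀ z) (by positivity)) hD2
    | succ k hk ih =>
      intro z₁ hz₁
      rw [Nat.add_sub_cancel] at hz₁
      by_cases hz₁B : z₁ ∈ B (k + 1)
      swap
      · rw [hGB (k + 1) x (by omega) z₁ hz₁B]; positivity
      obtain ⟨z, hzm, hzmax⟩ := Finset.exists_max_image
        ((B (k + 1)).filter fun z => 2 ^ k ≤ ρ z) (G (k + 1) x)
        ⟨z₁, Finset.mem_filter.2 ⟨hz₁B, hz₁⟩⟩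
      refine (hzmax z₁ (Finset.mem_filter.2 ⟨hz₁B, hz₁⟩)).trans ?_
      obtain ⟨hzB, hzρ⟩ := Finset.mem_filter.1 hzm
      set m := G (k + 1) x z with hm
      have hm0 : 0 ≤ m := hG0 (k + 1) x (by omega) z
      by_contra hlt
      push Not at hlt
      have hP : (0:ℝ) < ((2:ℝ) ^ (k + 1)) ^ e := by positivity
      set P : ℝ := ((2:ℝ) ^ (k + 1)) ^ e with hPd
      rw [div_lt_iff₀ hP] at hlt
      have hmpos : 0 < m := by
        rcases hm0.lt_or_eq with h | h
        · exact h
        · rw [← h] at hlt; linarith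
      have hmax' : ∀ v, 2 ^ k ≤ ρ v → G (k + 1) x v ≤ m := by
        intro v hv
        by_cases hvB : v ∈ B (k + 1)
        · exact hzmax v (Finset.mem_filter.2 ⟨hvB, hv⟩)
        · rw [hGB (k + 1) x (by omega) v hvB]; exact hm0
      have hcmp := hstepcmp k hk m hm0 hmax'
      set S : ℝ := m * (1 + 2 ^ e) with hS
      have hSpos : 0 < S := by positivity
      have hT2 : Real.sqrt (S / P) ^ 2 = S / P := Real.sq_sqrt (by positivity)
      have h1 := hone (Λ (k + 1)) (B (k + 1)) (hBΛ _ (by omega)) (hBne _ (by omega)) c hc hc0 ρ x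
        (G (k + 1) x) hρ hρx (hμ _ (by omega)) (k + 1) (by omega) (hN1 _ (by omega))
        (hN2 _ (by omega)) (hSob _ (by omega)) (hG0 _ x (by omega)) (hGB _ x (by omega))
        (hGΛ _ x (by omega)) S (Real.sqrt (S / P)) hSpos (Real.sqrt_pos.2 (by positivity))
        (fun v hv => by
          refine (hcmp v).trans ?_
          have h2 := ih v (by simpa [Nat.add_sub_cancel] using hv)
          have h3 : D / ((2:ℝ) ^ k) ^ e = D * 2 ^ e / P := by
            rw [hPd, pow_succ (2:ℝ) k, mul_pow]; field_simp
          have h4 : D * 2 ^ e / P ≤ m * 2 ^ e := by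
            rw [div_le_iff₀ hP]
            have : (0:ℝ) < 2 ^ e := by positivity
            nlinarith
          rw [hS]; rw [h3] at h2; linarith)
        (by
          rw [hT2, hPd, pow_add ((2:ℝ) ^ (k + 1)) e 2]; field_simp)
        z (by simpa [Nat.add_sub_cancel] using hzρ)
      have h5 : m ^ 2 ≤ C ^ 2 * (S / P) := by
        rw [← hT2, ← mul_pow]
        exact pow_le_pow_left₀ hm0 h1 2
      have h6 : m ^ 2 * P ≤ C ^ 2 * S := by
        calc m ^ 2 * P ≤ C ^ 2 * (S / P) * P := mul_le_mul_of_nonneg_right h5 hP.le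
          _ = C ^ 2 * S := by field_simp
      have h7 : m * (m * P) ≤ m * (C ^ 2 * (1 + 2 ^ e)) := by
        rw [hS] at h6; nlinarith
      have h8 := le_of_mul_le_mul_left h7 hmpos
      linarith
  refine ⟨2 * D, by linarith, fun y hy hρy => ?_⟩
  -- the scale of `y`
  obtain ⟨k, hk1, hk2⟩ : ∃ k, 2 ^ (k - 1) ≤ ρ y ∧ ρ y < 2 ^ k := by
    have h0 : ρ y ≠ 0 := by
      have : 0 < 2 ^ k₀ := by positivity
      omega
    exact ⟨Nat.log 2 (ρ y) + 1, by simpa using Nat.pow_log_le_self 2 h0,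
      Nat.lt_pow_succ_log_self (by norm_num) _⟩
  have hkk : k₀ ≤ k := by
    by_contra h
    have : 2 ^ k ≤ 2 ^ k₀ := Nat.pow_le_pow_right (by norm_num) (by omega)
    omega
  set Q : ℝ := D / ((2:ℝ) ^ k) ^ e with hQ
  have hQ0 : 0 < Q := by positivity
  have hsum : ∀ j, G (k + j) x y ≤ Q * (2 - (1 / 2) ^ j) := by
    intro j
    induction j with
    | zero =>
      have := hdecay k hkk y hk1
      simp only [add_zero, pow_zero]; linarith
    | succ j ih =>
      have hk' : k₀ ≤ k + j + 1 := by omega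
      have h1 := hstepcmp (k + j) (by omega) (D / ((2:ℝ) ^ (k + j + 1)) ^ e) (by positivity)
        (fun z hz => hdecay (k + j + 1) hk' z (by simpa using hz)) y
      have h2 : D / ((2:ℝ) ^ (k + j + 1)) ^ e ≤ Q * (1 / 2) ^ (j + 1) := by
        rw [hQ, add_assoc, pow_add (2:ℝ) k, mul_pow, one_div_pow, div_mul_div_comm, mul_one]
        have : (2:ℝ) ^ (j + 1) ≤ ((2:ℝ) ^ (j + 1)) ^ e :=
          le_self_pow₀ (one_le_pow₀ (by norm_num)) (by omega)
        gcongr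
      rw [← add_assoc]
      have h3 : ((1:ℝ) / 2) ^ (j + 1) = (1 / 2) ^ j / 2 := by rw [pow_succ]; ring
      rw [h3] at h2 ⊢
      nlinarith
  have hle : ∀ j, G (k₀ + j) x y ≤ 2 * Q := by
    intro j
    have h1 : G (k₀ + j) x y ≤ G (k₀ + (k - k₀ + j)) x y := hGmono' x y (by omega)
    have h2 := hsum j
    have e1 : k₀ + (k - k₀ + j) = k + j := by omega
    rw [e1] at h1
    have : (0:ℝ) < (1 / 2) ^ j := by positivity
    nlinarith
  refine (hglim y hy).trans ?_
  refine (ciSup_le fun j => ?_ : (⨆ j, G (k₀ + j) y x) ≤ 2 * Q).trans ?_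
  · rw [hGsymm (k₀ + j) (by omega) y]; exact hle j
  · rw [hQ, ← mul_div_assoc]
    have h0 : (0:ℝ) < ρ y := by
      have : 0 < 2 ^ k₀ := by positivity
      exact_mod_cast lt_of_lt_of_le this hρy
    have : (ρ y : ℝ) ≤ 2 ^ k := by exact_mod_cast hk2.le
    have hD0 : 0 < D := by linarith
    gcongr

end Abstract6

section Concrete
variable {d : ℕ}

lemma adj_comm' (y z : Vert d) : adj y z ↔ adj z y := by
  unfold adj
  rw [Finset.sum_congr rfl fun i _ => by rw [← Int.natAbs_neg, neg_sub]]

lemma openAdj_comm' (a : Vert d → Vert d → ℝ) (haSymm : ∀ x y, a x y = a y x) (y z : Vert d) :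
    openAdj a y z ↔ openAdj a z y := by
  unfold openAdj
  rw [adj_comm', haSymm]

lemma mem_nbrs_iff (y z : Vert d) : z ∈ nbrs y ↔ adj y z := by
  unfold nbrs adj
  simp only [Finset.mem_image, Finset.mem_univ, true_and]
  constructor
  · rintro ⟨⟨i, b⟩, rfl⟩
    rw [Finset.sum_eq_single i]
    · cases b <;> simp
    · intro j _ hj; simp [hj]
    · simp
  · intro h
    obtain ⟨i, -, hi⟩ : ∃ i ∈ (Finset.univ : Finset (Fin d)), (y i - z i).natAbs ≠ 0 := by
      apply Finset.exists_ne_zero_of_sum_ne_zero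
      rw [h]; norm_num
    have h2 := Finset.add_sum_erase Finset.univ (fun i => (y i - z i).natAbs) (Finset.mem_univ i)
    rw [h] at h2
    have h3 : ∑ j ∈ Finset.univ.erase i, (y j - z j).natAbs = 0 := by omega
    have h4 : ∀ j, j ≠ i → z j = y j := by
      intro j hj
      have := Finset.sum_eq_zero_iff.1 h3 j (Finset.mem_erase.2 ⟨hj, Finset.mem_univ j⟩)
      omega
    have h5 : (y i - z i).natAbs = 1 := by omega
    by_cases hs : z i = y i + 1
    · refine ⟨(i, true), ?_⟩
      funext j
      by_cases hj : j = i
      · subst hj; simp [hs]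
      · simp [hj, h4 j hj]
    · refine ⟨(i, false), ?_⟩
      funext j
      by_cases hj : j = i
      · subst hj; simp; omega
      · simp [hj, h4 j hj]

lemma isOpenPath_append (a : Vert d → Vert d → ℝ) (x y z : Vert d) (p : List (Vert d))
    (hp : IsOpenPath a x y p) (h : openAdj a y z) : IsOpenPath a x z (p ++ [z]) := by
  obtain ⟨h1, h2, h3⟩ := hp
  refine ⟨?_, ?_, ?_⟩
  · rw [List.head?_append, h1]; rfl
  · simp
  · unfold List.Chain' at *
    rw [List.isChain_append]
    refine ⟨h3, by simp, ?_⟩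
    intro u hu v hv
    rw [h2] at hu
    simp at hu hv
    subst hu; subst hv; exact h

lemma isOpenPath_ne_nil (a : Vert d → Vert d → ℝ) (x y : Vert d) (p : List (Vert d))
    (hp : IsOpenPath a x y p) : 1 ≤ p.length := by
  obtain ⟨h1, _, _⟩ := hp
  cases p with
  | nil => simp at h1
  | cons _ _ => simp

lemma isOpenPath_single (a : Vert d → Vert d → ℝ) (x : Vert d) : IsOpenPath a x x [x] := by
  refine ⟨by simp, by simp, ?_⟩
  unfold List.Chain'
  simp

lemma openConn_iff (a : Vert d → Vert d → ℝ) (x y : Vert d) :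
    openConn a x y ↔ Relation.ReflTransGen (openAdj a) x y := by
  constructor
  · rintro ⟨p, hp⟩
    induction p generalizing x with
    | nil => exact absurd hp.1 (by simp)
    | cons u t ih =>
      obtain ⟨h1, h2, h3⟩ := hp
      simp at h1
      subst h1
      cases t with
      | nil =>
        simp at h2
        subst h2; exact Relation.ReflTransGen.refl
      | cons v t =>
        unfold List.Chain' at h3
        rw [List.isChain_cons_cons] at h3
        refine Relation.ReflTransGen.head h3.1 (ih v ⟨by simp, ?_, h3.2⟩)
        simpa using h2
  · intro h
    induction h with
    | refl => exact ⟨[x], isOpenPath_single a x⟩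
    | tail _ h ih =>
      obtain ⟨p, hp⟩ := ih
      exact ⟨_, isOpenPath_append a x _ _ p hp h⟩

lemma openConn_symm' (a : Vert d → Vert d → ℝ) (haSymm : ∀ x y, a x y = a y x) (x y : Vert d)
    (h : openConn a x y) : openConn a y x := by
  rw [openConn_iff] at *
  induction h with
  | refl => exact Relation.ReflTransGen.refl
  | tail _ h ih => exact Relation.ReflTransGen.head ((openAdj_comm' a haSymm _ _).1 h) ih

lemma cinf_of_conn (a : Vert d → Vert d → ℝ) (haSymm : ∀ x y, a x y = a y x) (x y : Vert d)
    (hx : x ∈ Cinf a) (h : openConn a x y) : y ∈ Cinf a := by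
  unfold Cinf at *
  refine Set.Infinite.mono ?_ hx
  intro z hz
  have h1 := openConn_symm' a haSymm x y h
  simp only [Set.mem_setOf_eq] at hz ⊢
  rw [openConn_iff] at *
  exact h1.trans hz

/-- Natural-number version of the chemical distance from `x`. -/
noncomputable def rhoN (a : Vert d → Vert d → ℝ) (x z : Vert d) : ℕ :=
  sInf {n : ℕ | ∃ p, IsOpenPath a x z p ∧ p.length - 1 = n}

lemma rhoN_le (a : Vert d → Vert d → ℝ) (x z : Vert d) (p : List (Vert d))
    (hp : IsOpenPath a x z p) : rhoN a x z ≤ p.length - 1 := Nat.sInf_le ⟨p, hp, rfl⟩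

lemma rhoN_spec (a : Vert d → Vert d → ℝ) (x z : Vert d) (h : openConn a x z) :
    ∃ p, IsOpenPath a x z p ∧ p.length - 1 = rhoN a x z := by
  obtain ⟨p, hp⟩ := h
  exact Nat.sInf_mem (s := {n : ℕ | ∃ p, IsOpenPath a x z p ∧ p.length - 1 = n})
    ⟨p.length - 1, p, hp, rfl⟩

lemma rhoN_self (a : Vert d → Vert d → ℝ) (x : Vert d) : rhoN a x x = 0 := by
  have := rhoN_le a x x [x] (isOpenPath_single a x)
  simpa using this

lemma chemDist_eq (a : Vert d → Vert d → ℝ) (x z : Vert d) (h : openConn a x z) :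
    chemDist a x z = (rhoN a x z : ℝ≥0∞) := by
  unfold chemDist
  apply le_antisymm
  · obtain ⟨p, hp, hl⟩ := rhoN_spec a x z h
    rw [← hl]
    exact iInf_le (fun p : {p : List (Vert d) // IsOpenPath a x z p} =>
      ((p.1.length - 1 : ℕ) : ℝ≥0∞)) ⟨p, hp⟩
  · refine le_iInf fun p => ?_
    exact_mod_cast rhoN_le a x z p.1 p.2

lemma chemDist_top (a : Vert d → Vert d → ℝ) (x z : Vert d) (h : ¬ openConn a x z) :
    chemDist a x z = ∞ := by
  unfold chemDist
  rw [iInf_eq_top]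
  intro p
  exact absurd ⟨p.1, p.2⟩ h

lemma rhoN_lip (a : Vert d → Vert d → ℝ) (haSymm : ∀ x y, a x y = a y x) (x y z : Vert d)
    (h : openAdj a y z) : rhoN a x y ≤ rhoN a x z + 1 := by
  by_cases hz : openConn a x z
  · obtain ⟨p, hp, hl⟩ := rhoN_spec a x z hz
    have h1 := rhoN_le a x y _ (isOpenPath_append a x z y p hp ((openAdj_comm' a haSymm _ _).1 h))
    have h2 := isOpenPath_ne_nil a x z p hp
    simp at h1
    omega
  · have : rhoN a x y = 0 := by
      unfold rhoN
      have : {n : ℕ | ∃ p, IsOpenPath a x y p ∧ p.length - 1 = n} = ∅ := by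
        ext n
        simp only [Set.mem_setOf_eq, Set.mem_empty_iff_false, iff_false]
        rintro ⟨p, hp, _⟩
        exact hz ⟨_, isOpenPath_append a x y z p hp h⟩
      rw [this]; simp
    omega

lemma mem_ballCh_iff (a : Vert d → Vert d → ℝ) (haSymm : ∀ x y, a x y = a y x)
    (huniq : ∀ x ∈ Cinf a, ∀ y ∈ Cinf a, openConn a x y) (x : Vert d) (hx : x ∈ Cinf a)
    (n : ℕ) (y : Vert d) : y ∈ ballCh a x (n : ℝ) ↔ y ∈ Cinf a ∧ rhoN a x y ≤ n := by
  unfold ballCh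
  simp only [Set.mem_setOf_eq, ENNReal.ofReal_natCast]
  constructor
  · intro h
    have hc : openConn a x y := by
      by_contra hc
      rw [chemDist_top a x y hc] at h
      simp at h
    refine ⟨cinf_of_conn a haSymm x y hx hc, ?_⟩
    rw [chemDist_eq a x y hc] at h
    exact_mod_cast h
  · rintro ⟨h1, h2⟩
    rw [chemDist_eq a x y (huniq x hx y h1)]
    exact_mod_cast h2

lemma avgNormR_finset (p : ℝ≥0∞) (hp : p ≠ ∞) (B : Finset (Vert d)) (f : Vert d → ℝ) :
    avgNormR p (B : Set (Vert d)) f =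
      ((∑ y ∈ B, |f y| ^ p.toReal) / (B.card : ℝ)) ^ (1 / p.toReal) := by
  unfold avgNormR
  rw [if_neg hp, Set.ncard_coe_finset]
  congr 2
  exact Finset.tsum_subtype B (fun y => |f y| ^ p.toReal)

/-- Reduction of the integrability exponent to a finite one. -/
lemma exponent_reduction (p : ℝ≥0∞) (hp : 1 < p) (C : ℝ) (hC : 0 < C) (ε : ℝ) (hε : 0 < ε) :
    ∃ p' : ℝ, 1 < p' ∧ 1 / p' < (1 / p).toReal + ε ∧
      ∀ (B : Finset (Vert d)) (f : Vert d → ℝ), B.Nonempty → (∀ y, 0 ≤ f y) →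
        avgNormR p (B : Set (Vert d)) f ≤ C → ∑ y ∈ B, f y ^ p' ≤ C ^ p' * B.card := by
  by_cases h : p = ∞
  · refine ⟨1 + 1 / ε, ?_, ?_, ?_⟩
    · have : 0 < 1 / ε := by positivity
      linarith
    · subst h
      simp
      rw [inv_lt_comm₀ (by positivity) hε]
      linarith
    · intro B f _ hf hB
      unfold avgNormR at hB
      rw [if_pos h] at hB
      rw [mul_comm, ← nsmul_eq_mul]
      refine Finset.sum_le_card_nsmul _ _ _ fun y hy => ?_
      refine Real.rpow_le_rpow (hf y) ?_ (by positivity)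
      refine le_trans ?_ hB
      refine (le_abs_self _).trans (le_csSup ?_ ⟨y, hy, rfl⟩)
      exact (B.finite_toSet.image _).bddAbove
  · have hp1 : 1 < p.toReal := by
      have := (ENNReal.toReal_lt_toReal (by simp) h).2 hp
      simpa using this
    refine ⟨p.toReal, hp1, ?_, ?_⟩
    · rw [ENNReal.toReal_div]; simp; exact hε
    · intro B f hB hf hle
      rw [avgNormR_finset p h] at hle
      have hN : (0 : ℝ) < B.card := by exact_mod_cast hB.card_pos
      have e : ∑ y ∈ B, |f y| ^ p.toReal = ∑ y ∈ B, f y ^ p.toReal :=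
        Finset.sum_congr rfl fun y _ => by rw [abs_of_nonneg (hf y)]
      rw [e] at hle
      have h0 : 0 ≤ (∑ y ∈ B, f y ^ p.toReal) / (B.card : ℝ) :=
        div_nonneg (Finset.sum_nonneg fun y _ => Real.rpow_nonneg (hf y) _) hN.le
      have h1 := Real.rpow_le_rpow (Real.rpow_nonneg h0 _) hle (by linarith : 0 ≤ p.toReal)
      rw [← Real.rpow_mul h0, one_div_mul_cancel (by linarith), Real.rpow_one,
        div_le_iff₀ hN] at h1
      exact h1

/-- The conductance extended by zero off the open lattice edges. -/
noncomputable def cnd (a : Vert d → Vert d → ℝ) (y z : Vert d) : ℝ :=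
  if openAdj a y z then a y z else 0

lemma cnd_pos_iff (a : Vert d → Vert d → ℝ) (y z : Vert d) : 0 < cnd a y z ↔ openAdj a y z := by
  unfold cnd
  split_ifs with h
  · exact ⟨fun _ => h, fun _ => h.2⟩
  · simp [h]

lemma cnd_nbrs (a : Vert d → Vert d → ℝ) (ha : ∀ x y, 0 ≤ a x y) (y z : Vert d)
    (h : z ∈ nbrs y) : cnd a y z = a y z := by
  unfold cnd
  split_ifs with h'
  · rfl
  · have : ¬ 0 < a y z := fun hh => h' ⟨(mem_nbrs_iff y z).1 h, hh⟩
    linarith [ha y z]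

lemma cnd_not_nbrs (a : Vert d → Vert d → ℝ) (y z : Vert d) (h : z ∉ nbrs y) :
    cnd a y z = 0 := by
  unfold cnd
  rw [if_neg]
  intro h'
  exact h ((mem_nbrs_iff y z).2 h'.1)

lemma muA_eq (a : Vert d → Vert d → ℝ) (ha : ∀ x y, 0 ≤ a x y) (Λ : Finset (Vert d)) (y : Vert d)
    (h : nbrs y ⊆ Λ) : ∑ z ∈ Λ, cnd a y z = muA a y := by
  unfold muA
  rw [← Finset.sum_subset h fun z _ hz => cnd_not_nbrs a y z hz]
  exact Finset.sum_congr rfl fun z hz => cnd_nbrs a ha y z hz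

lemma nuA_eq (a : Vert d → Vert d → ℝ) (ha : ∀ x y, 0 ≤ a x y) (Λ : Finset (Vert d)) (y : Vert d)
    (h : nbrs y ⊆ Λ) : ∑ z ∈ Λ, (cnd a y z)⁻¹ = nuA a y := by
  unfold nuA
  rw [← Finset.sum_subset h fun z _ hz => by rw [cnd_not_nbrs a y z hz, _root_.inv_zero]]
  refine Finset.sum_congr rfl fun z hz => ?_
  rw [cnd_nbrs a ha y z hz]
  split_ifs with h
  · rfl
  · have : a y z = 0 := le_antisymm (not_lt.1 h) (ha y z)
    rw [this, _root_.inv_zero]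

lemma genL_eq (a : Vert d → Vert d → ℝ) (ha : ∀ x y, 0 ≤ a x y) (f : Vert d → ℝ) (y : Vert d) :
    ∑ z ∈ nbrs y, cnd a y z * (f y - f z) = - genL a (fun _ => 0) 0 f y := by
  unfold genL
  rw [Finset.sum_congr rfl fun z hz => by rw [cnd_nbrs a ha y z hz]]
  simp only [zero_mul, sub_zero]
  rw [← Finset.sum_neg_distrib]
  exact Finset.sum_congr rfl fun z _ => by ring

lemma edgeGradSum_eq (a : Vert d → Vert d → ℝ) (haSymm : ∀ x y, a x y = a y x)
    (Λ B : Finset (Vert d)) (hBΛ : B ⊆ Λ) (h : ∀ y ∈ B, nbrs y ⊆ Λ) (F : Vert d → ℝ)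
    (hF : ∀ y, y ∉ B → F y = 0) :
    edgeGradSum a F =
      1 / 2 * ∑ y ∈ Λ, ∑ z ∈ Λ, if 0 < cnd a y z then |F y - F z| else 0 := by
  unfold edgeGradSum
  rw [tsum_eq_sum (s := Λ ×ˢ Λ), Finset.sum_product]
  · congr 1
    refine Finset.sum_congr rfl fun y _ => Finset.sum_congr rfl fun z _ => ?_
    simp only [cnd_pos_iff]
    rw [abs_sub_comm]
  · rintro ⟨y, z⟩ hyz
    split_ifs with ho
    swap
    · rfl
    have hyB : y ∉ B := fun hy => hyz (Finset.mem_product.2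
      ⟨hBΛ hy, h y hy ((mem_nbrs_iff y z).2 ho.1)⟩)
    have hzB : z ∉ B := fun hz => hyz (Finset.mem_product.2
      ⟨h z hz ((mem_nbrs_iff z y).2 ((adj_comm' y z).1 ho.1)), hBΛ hz⟩)
    simp [hF y hyB, hF z hzB]

end Concrete

/-- Proposition `prop:green`: for `d ≥ 3`, under the graph
assumption and averaged integrability of `μ^ω` and `ν^ω` on large balls, the
Green function of the random walk among the conductances `a` (without killing)
decays like the `(2-d)`-th power of the chemical distance. -/
theorem statement9
    {d : ℕ} (hd : 3 ≤ d)
    (a : Vert d → Vert d → ℝ)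
    (haSymm : ∀ x y, a x y = a y x) (haNonneg : ∀ x y, 0 ≤ a x y)
    -- the infinite cluster is (assumed) unique
    (huniq : ∀ x ∈ Cinf a, ∀ y ∈ Cinf a, openConn a x y)
    (d' : ℝ) (N4 N5 : Vert d → ℕ) (Creg CS1 : ℝ)
    (hGA : GraphAssumption d' a N4 N5 Creg CS1)
    (p q : ℝ≥0∞) (hp : 1 < p) (hq : 1 < q)
    (hpq : 1 / p + 1 / q < ENNReal.ofReal (2 / d'))
    (Cint : ℝ) (hCint : 0 < Cint)
    (N7 : Vert d → ℕ)
    (hint : ∀ x ∈ Cinf a, ∀ n : ℕ, N7 x ≤ n →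
      avgNormR p (ballCh a x (n : ℝ)) (muA a) ≤ Cint ∧
      avgNormR q (ballCh a x (n : ℝ)) (nuA a) ≤ Cint)
    -- the Green function of the walk with conductances `a` and no killing
    (g : Vert d → Vert d → ℝ)
    (hg : IsGreenFn a (fun _ => 0) 0 (Cinf a) g)
    (x : Vert d) (hx : x ∈ Cinf a) :
    ∃ c21 : ℝ, 0 < c21 ∧ ∃ N : ℕ, ∀ y ∈ Cinf a, (N : ℝ≥0∞) ≤ chemDist a x y →
      g x y ≤ c21 * (chemDist a x y).toReal ^ ((2:ℝ) - d) := by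
  obtain ⟨hCreg, hCS1, hdd', hvol, hsob⟩ := hGA
  have hd'3 : (3:ℝ) ≤ d' := le_trans (by exact_mod_cast hd) hdd'
  have hd'0 : 0 < d' := by linarith
  -- finite exponents
  have hpqR : (1 / p).toReal + (1 / q).toReal < 2 / d' := by
    have hne : 1 / p + 1 / q ≠ ∞ := hpq.ne_top
    rw [ENNReal.add_ne_top] at hne
    rw [← ENNReal.toReal_add hne.1 hne.2]
    have := (ENNReal.toReal_lt_toReal (ENNReal.add_ne_top.2 hne) ENNReal.ofReal_ne_top).2 hpq
    rwa [ENNReal.toReal_ofReal (by positivity)] at this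
  set ε : ℝ := (2 / d' - ((1 / p).toReal + (1 / q).toReal)) / 2 with hε
  have hε0 : 0 < ε := by rw [hε]; linarith
  obtain ⟨p', hp'1, hp'ε, hp'⟩ := exponent_reduction (d := d) p hp Cint hCint ε hε0
  obtain ⟨q', hq'1, hq'ε, hq'⟩ := exponent_reduction (d := d) q hq Cint hCint ε hε0
  have hpq' : 1 / p' + 1 / q' < 2 / d' := by
    have : (1 / p).toReal + ε + ((1 / q).toReal + ε) = 2 / d' := by rw [hε]; ring
    linarith
  have hq'0 : 0 < 1 / q' := by positivity
  have hp'0 : 0 < 1 / p' := by positivity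
  have hq'lt : 1 / q' < 1 := by rw [div_lt_one (by linarith)]; exact hq'1
  have hd'lt : 1 / d' ≤ 1 / 3 := one_div_le_one_div_of_le (by norm_num) hd'3
  have h2d : 2 / d' = 2 * (1 / d') := by ring
  set s : ℝ := 1 / 2 - 1 / d' + 1 / q' / 2 with hs
  have hs0 : 0 < s := by rw [hs]; linarith
  set σ : ℝ := d' / (d' - 1) with hσ
  have hσ0 : 0 < σ := div_pos hd'0 (by linarith)
  have hσinv : 1 / σ = 1 - 1 / d' := by
    rw [hσ]; field_simp
  have hrel : 1 / (1 / s) = 1 / σ - (q' - 1) / (2 * q') := by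
    rw [hσinv, one_div_one_div, hs]; field_simp; ring
  have hσr : σ < 1 / s := by
    rw [lt_one_div hσ0 hs0, hσinv, hs]; linarith
  have hr : 2 * (p' / (p' - 1)) < 1 / s := by
    have hpp : 0 < 2 * (p' / (p' - 1)) := by
      have : 0 < p' / (p' - 1) := div_pos (by linarith) (by linarith)
      linarith
    rw [lt_one_div hpp hs0]
    have e1 : 1 / (2 * (p' / (p' - 1))) = 1 / 2 - 1 / p' / 2 := by
      have : p' - 1 ≠ 0 := by linarith
      field_simp
    rw [e1, hs]; linarith
  set r : ℝ := 1 / s with hrd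
  have hr0 : 0 < r := by positivity
  -- the scales
  set k₀ : ℕ := N4 x + N5 x + N7 x + 3 with hk₀
  have hpow : ∀ k, k₀ ≤ k → N4 x ≤ 2 ^ k ∧ N5 x ≤ 2 ^ k ∧ N7 x ≤ 2 ^ k := by
    intro k hk
    have := (Nat.lt_two_pow_self (n := k)).le
    omega
  have hfin : ∀ k, k₀ ≤ k → (ballCh a x ((2 ^ k : ℕ) : ℝ)).Finite := by
    intro k hk
    apply Set.finite_of_ncard_pos
    have h1 := (hvol x hx (2 ^ k) (hpow k hk).1).1
    have h2 : (0:ℝ) < Creg⁻¹ * ((2 ^ k : ℕ) : ℝ) ^ d := by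
      have : 0 < Creg := by linarith
      positivity
    exact_mod_cast h2.trans_le h1
  let B : ℕ → Finset (Vert d) := fun k =>
    if h : (ballCh a x ((2 ^ k : ℕ) : ℝ)).Finite then h.toFinset else ∅
  have hBcoe : ∀ k, k₀ ≤ k → (B k : Set (Vert d)) = ballCh a x ((2 ^ k : ℕ) : ℝ) := by
    intro k hk
    simp only [B]
    rw [dif_pos (hfin k hk)]
    simp
  let Λ : ℕ → Finset (Vert d) := fun k => B k ∪ (B k).biUnion nbrs
  have hBΛ : ∀ k, B k ⊆ Λ k := fun k => Finset.subset_union_left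
  have hnb : ∀ k, ∀ y ∈ B k, nbrs y ⊆ Λ k := fun k y hy =>
    (Finset.subset_biUnion_of_mem nbrs hy).trans Finset.subset_union_right
  have hCS0 : 0 < CS1 := by linarith
  clear_value Λ B
  have hBK : ∀ k, k₀ ≤ k → ∀ y, y ∈ B k ↔ y ∈ Cinf a ∧ rhoN a x y ≤ 2 ^ k := by
    intro k hk y
    rw [← mem_ballCh_iff a haSymm huniq x hx (2 ^ k) y, ← hBcoe k hk, Finset.mem_coe]
  have hBne : ∀ k, k₀ ≤ k → (B k).Nonempty := fun k hk =>
    ⟨x, (hBK k hk x).2 ⟨hx, by rw [rhoN_self]; positivity⟩⟩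
  have hcsymm : ∀ y z, cnd a y z = cnd a z y := by
    intro y z
    unfold cnd
    simp only [openAdj_comm' a haSymm y z, haSymm y z]
  have hc0 : ∀ y z, 0 ≤ cnd a y z := by
    intro y z
    unfold cnd
    split_ifs
    · exact haNonneg y z
    · exact le_rfl
  have hcard : ∀ k, k₀ ≤ k → (ballCh a x ((2 ^ k : ℕ) : ℝ)).ncard = (B k).card := by
    intro k hk
    rw [← hBcoe k hk, Set.ncard_coe_finset]
  have hmu0 : ∀ y, 0 ≤ muA a y := fun y => Finset.sum_nonneg fun z _ => haNonneg y z
  have hnu0 : ∀ y, 0 ≤ nuA a y := fun y => Finset.sum_nonneg fun z _ => by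
    split_ifs
    · exact inv_nonneg.2 (haNonneg y z)
    · exact le_rfl
  have hμ : ∀ k, k₀ ≤ k →
      ∑ y ∈ B k, (∑ z ∈ Λ k, cnd a y z) ^ p' ≤ Cint ^ p' * (B k).card := by
    intro k hk
    rw [Finset.sum_congr rfl fun y hy => by rw [muA_eq a haNonneg (Λ k) y (hnb k y hy)]]
    refine hp' (B k) (muA a) (hBne k hk) hmu0 ?_
    rw [hBcoe k hk]
    exact (hint x hx (2 ^ k) (hpow k hk).2.2).1
  have hν : ∀ k, k₀ ≤ k →
      ∑ y ∈ B k, (∑ z ∈ Λ k, (cnd a y z)⁻¹) ^ q' ≤ Cint ^ q' * (B k).card := by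
    intro k hk
    rw [Finset.sum_congr rfl fun y hy => by rw [nuA_eq a haNonneg (Λ k) y (hnb k y hy)]]
    refine hq' (B k) (nuA a) (hBne k hk) hnu0 ?_
    rw [hBcoe k hk]
    exact (hint x hx (2 ^ k) (hpow k hk).2.2).2
  have hSob1 : ∀ k, k₀ ≤ k →
      Sob (Λ k) (B k) (cnd a) σ (CS1 * (2:ℝ) ^ k / (B k).card) := by
    intro k hk F hF hFB
    have h1 := hsob x hx (2 ^ k) (hpow k hk).2.1 F (fun y hy => by
      rw [← hBcoe k hk]
      by_contra hyB
      exact hy (hFB y hyB))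
    rw [hcard k hk, ← hBcoe k hk, avgNormR_finset _ ENNReal.ofReal_ne_top,
      ENNReal.toReal_ofReal hσ0.le,
      edgeGradSum_eq a haSymm (Λ k) (B k) (hBΛ k) (hnb k) F hFB] at h1
    rw [Finset.sum_congr rfl fun y _ => by rw [abs_of_nonneg (hF y)]] at h1
    push_cast at h1
    exact h1
  have hSob2 : ∀ k, k₀ ≤ k → ∀ f : Vert d → ℝ, (∀ y, 0 ≤ f y) → (∀ y, y ∉ B k → f y = 0) →
        ((∑ y ∈ B k, f y ^ r) / ((B k).card : ℝ)) ^ (2 / r) ≤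
          ((CS1 * (r / σ)) ^ 2 * Cint) * ((2:ℝ) ^ k) ^ 2 / (B k).card * En (Λ k) (cnd a) f := by
    intro k hk f hf hfB
    have hN : (0 : ℝ) < (B k).card := by exact_mod_cast (hBne k hk).card_pos
    have h1 := sobL2 (Λ k) (B k) (hBΛ k) (hBne k hk) (cnd a) hcsymm hc0 σ q' r
      (CS1 * (2:ℝ) ^ k / (B k).card) Cint hσ0 hq'1 (by positivity) hCint.le hr0 hσr hrel
      (hν k hk) (hSob1 k hk) f hf hfB
    refine h1.trans (le_of_eq ?_)
    field_simp
  obtain ⟨hg0, hgL, hgmin⟩ := hg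
  have hde : d - 2 + 2 = d := by omega
  obtain ⟨D, hD, hmain⟩ := abstract_green (V := Vert d) (d - 2) (by omega) p' r
    ((CS1 * (r / σ)) ^ 2 * Cint) Cint Creg hp'1 hr (by positivity) hCint (by linarith)
    (cnd a) hcsymm hc0 (rhoN a x)
    (fun y z h => rhoN_lip a haSymm x y z ((cnd_pos_iff a y z).1 h)) x (rhoN_self a x)
    (Cinf a) nbrs B Λ k₀ (by omega) hBK (fun k _ => hBΛ k) (fun k _ => hnb k)
    (fun y z h => cnd_not_nbrs a y z h) hx hμ
    (fun k hk => by
      have := (hvol x hx (2 ^ k) (hpow k hk).1).1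
      rw [hcard k hk] at this
      rw [hde]; push_cast at this; exact this)
    (fun k hk => by
      have := (hvol x hx (2 ^ k) (hpow k hk).1).2
      rw [hcard k hk] at this
      rw [hde]; push_cast at this; exact this)
    hSob2 g hg0
    (fun y hy z hz => by
      rw [genL_eq a haNonneg (fun w => g w y) z, hgL y hy z hz, neg_neg]
      split_ifs <;> rfl)
    (fun g' hg'0 hg'L y hy z hz => hgmin g' hg'0 (fun y hy z hz => by
      have := hg'L y hy z hz
      rw [genL_eq a haNonneg (fun w => g' w y) z] at this
      refine le_of_eq ?_
      rw [← neg_eq_iff_eq_neg, this]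
      split_ifs <;> rfl) y hy z hz)
  refine ⟨D, hD, 2 ^ k₀, fun y hy hle => ?_⟩
  have hcd := chemDist_eq a x y (huniq x hx y hy)
  rw [hcd] at hle ⊢
  have hle' : 2 ^ k₀ ≤ rhoN a x y := by exact_mod_cast hle
  refine (hmain y hy hle').trans (le_of_eq ?_)
  rw [ENNReal.toReal_natCast]
  have e1 : (2:ℝ) - d = -((d - 2 : ℕ) : ℝ) := by
    rw [Nat.cast_sub (by omega)]; push_cast; ring
  rw [e1, Real.rpow_neg (by positivity), Real.rpow_natCast, div_eq_mul_inv]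


end FPPPaper
end
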